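/- arXiv:1302.2486 — 3 statements merged into one kernel-verified Lean document; each statement's English description precedes it below -/
import Mathlib

section
/- For every a ∈ (1/4,1/2): a + 1/4 ≤ φ(a) ≤ a + 1/3 and a + (1/4)·∏_{j=1}^∞ (1 − 2^{−2ʲ}) ≤ χ(a) ≤ a + 1/4. -/
noncomputable section

/-- The doubling map. -/
def Dbl (x : ℝ) : ℝ := if x ≤ 1/2 then 2*x else 2*x - 1

/-- Survivor set `𝒥(a,b)`. -/
def J (a b : ℝ) : Set ℝ := {x ∈ Set.Icc (0:ℝ) 1 | ∀ n : ℕ, Dbl^[n] x ∉ Set.Ioo a b}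

/-- The shift on binary sequences. -/
def shft (x : ℕ → Bool) : ℕ → Bool := fun n => x (n+1)

/-- Binary expansion value. -/
def piMap (w : ℕ → Bool) : ℝ := ∑' n : ℕ, (if w n then (1:ℝ) else 0) / 2 ^ (n+1)

/-- Strict lexicographic order on binary sequences. -/
def seqLt (u v : ℕ → Bool) : Prop := ∃ n, (∀ i < n, u i = v i) ∧ u n < v n

def seqLe (u v : ℕ → Bool) : Prop := seqLt u v ∨ u = v

/-- Periodic sequence `w^∞` associated with a finite word. -/
def per (w : List Bool) : ℕ → Bool := fun n => w.getD (n % w.length) false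

/-- Concatenation of a finite word and an infinite sequence. -/
def cat (w : List Bool) (x : ℕ → Bool) : ℕ → Bool :=
  fun n => if n < w.length then w.getD n false else x (n - w.length)

/-- A finite word is balanced. -/
def BalancedWord (l : List Bool) : Prop :=
  ∀ u v : List Bool, u <:+: l → v <:+: l → u.length = v.length →
    (u.count true : ℤ) - (v.count true : ℤ) ≤ 1

/-- A finite word is cyclically balanced. -/
def CycBalanced (w : List Bool) : Prop := BalancedWord (w ++ w)

def OmegaSet (r : ℚ) (b : Bool) : Set (List Bool) :=
  {w | w.length = r.den ∧ w.count true = r.num.toNat ∧ CycBalanced w ∧ w.head? = some b}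

/-- `w` is the lexicographically largest cyclically balanced word of length `q`
with `p` ones beginning with 0, where `r = p/q` in lowest terms. -/
def IsOmegaMinus (r : ℚ) (w : List Bool) : Prop :=
  w ∈ OmegaSet r false ∧ ∀ v ∈ OmegaSet r false, v = w ∨ List.Lex (· < ·) v w

/-- `w` is the lexicographically smallest cyclically balanced word of length `q`
with `p` ones beginning with 1. -/
def IsOmegaPlus (r : ℚ) (w : List Bool) : Prop :=
  w ∈ OmegaSet r true ∧ ∀ v ∈ OmegaSet r true, v = w ∨ List.Lex (· < ·) w v

open Classical in
def omegaMinus (r : ℚ) : List Bool :=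
  if h : ∃ w, IsOmegaMinus r w then h.choose else []

open Classical in
def omegaPlus (r : ℚ) : List Bool :=
  if h : ∃ w, IsOmegaPlus r w then h.choose else []

/-- The substitution `ρ_r` applied to a word. -/
def substR (r : ℚ) (w : List Bool) : List Bool :=
  (w.map (fun b => if b then omegaPlus r else omegaMinus r)).flatten

/-- `s_n = ρ_{r_1}∘⋯∘ρ_{r_n}(0)`. -/
def sWord : List ℚ → List Bool
  | [] => [false]
  | r :: rs => substR r (sWord rs)

/-- `t_n = ρ_{r_1}∘⋯∘ρ_{r_n}(1)`. -/
def tWord : List ℚ → List Bool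
  | [] => [true]
  | r :: rs => substR r (tWord rs)

/-- `Δ(r_1,…,r_n) = [π(s_n^∞), π(s_n t_n^∞)]`. -/
def DeltaI (rs : List ℚ) : Set ℝ :=
  Set.Icc (piMap (per (sWord rs))) (piMap (cat (sWord rs) (per (tWord rs))))

/-- `Δ̃(r_1,…,r_n) = [π(s_n t_n s_n^∞), π(s_n t_n^∞)]`. -/
def DeltaTilde (rs : List ℚ) : Set ℝ :=
  Set.Icc (piMap (cat (sWord rs) (cat (tWord rs) (per (sWord rs)))))
    (piMap (cat (sWord rs) (per (tWord rs))))

/-- The exceptional set `𝒮`. -/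
def Scal : Set ℝ :=
  Set.Ioo (1/4 : ℝ) (1/2) \ ⋃ r ∈ {r : ℚ | 0 < r ∧ r < 1}, DeltaI [r]

/-- `φ(a)`. -/
def phi (a : ℝ) : ℝ := sSup {b | b ∈ Set.Ioo a 1 ∧ J a b ≠ ({0, 1} : Set ℝ)}

/-- `χ(a)`. -/
def chi (a : ℝ) : ℝ := sSup {b | b ∈ Set.Ioo a 1 ∧ ¬ (J a b).Countable}

/-- `s_n` built from the first `m` entries of an infinite sequence of rationals. -/
def sWordN (r : ℕ → ℚ) (m : ℕ) : List Bool := sWord (List.ofFn fun i : Fin m => r i)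

def tWordN (r : ℕ → ℚ) (m : ℕ) : List Bool := tWord (List.ofFn fun i : Fin m => r i)

/-- `𝔰(𝐫)`, the coordinatewise limit of `ρ_{r_1}⋯ρ_{r_n}(0)`. -/
def sLim (r : ℕ → ℚ) : ℕ → Bool := fun k => (sWordN r (k+1)).getD k false

/-- `𝔱(𝐫)`. -/
def tLim (r : ℕ → ℚ) : ℕ → Bool := fun k => (tWordN r (k+1)).getD k false

lemma dbl_le {x : ℝ} (h : x ≤ 1/2) : Dbl x = 2*x := by
  unfold Dbl; rw [if_pos h]
lemma dbl_gt {x : ℝ} (h : 1/2 < x) : Dbl x = 2*x - 1 := by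
  have : ¬ x ≤ 1/2 := not_le.2 h
  unfold Dbl; rw [if_neg this]

lemma dbl_mem {x : ℝ} (h : x ∈ Set.Icc (0:ℝ) 1) : Dbl x ∈ Set.Icc (0:ℝ) 1 := by
  obtain ⟨h0, h1⟩ := h
  rcases le_or_gt x (1/2) with h | h
  · rw [dbl_le h]; constructor <;> linarith
  · rw [dbl_gt h]; constructor <;> linarith

lemma J_dbl {a b x : ℝ} (h : x ∈ J a b) : Dbl x ∈ J a b := by
  refine ⟨dbl_mem h.1, fun n => ?_⟩
  have := h.2 (n+1)
  rwa [Function.iterate_succ_apply] at this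

lemma J_iter {a b x : ℝ} (h : x ∈ J a b) (n : ℕ) : Dbl^[n] x ∈ J a b := by
  induction n with
  | zero => simpa using h
  | succ n ih => rw [Function.iterate_succ_apply']; exact J_dbl ih

lemma J_side {a b x : ℝ} (h : x ∈ J a b) : x ≤ a ∨ b ≤ x := by
  have := h.2 0
  simp only [Function.iterate_zero, id, Set.mem_Ioo, not_and_or, not_lt] at this
  exact this

lemma J_mono {a b a' b' : ℝ} (h1 : a ≤ a') (h2 : b' ≤ b) : J a b ⊆ J a' b' := by
  intro x hx
  refine ⟨hx.1, fun n hn => hx.2 n ⟨?_, ?_⟩⟩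
  · exact lt_of_le_of_lt h1 hn.1
  · exact lt_of_lt_of_le hn.2 h2

lemma J_up {a b : ℝ} (ha : a < 1/2) (n : ℕ) : ∀ x : ℝ, x ∈ J a b → 0 < x → x ≤ a →
    a < 2^n * x → ∃ y ∈ J a b, 0 < y ∧ y ≤ a ∧ b ≤ Dbl y ∧ ∃ m, y = Dbl^[m] x := by
  induction n with
  | zero => intro x _ _ h1 h2; simp at h2; linarith
  | succ n ih =>
    intro x hx h0 h1 h2
    have hd : Dbl x = 2*x := dbl_le (by linarith)
    rcases J_side (J_dbl hx) with h | h
    · obtain ⟨y, hy, h3, h4, h5, m, h6⟩ := ih (Dbl x) (J_dbl hx) (by rw [hd]; linarith) h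
        (by rw [hd]; rw [pow_succ] at h2; linarith)
      exact ⟨y, hy, h3, h4, h5, m+1, by rw [Function.iterate_succ_apply]; exact h6⟩
    · exact ⟨x, hx, h0, h1, h, 0, rfl⟩

lemma J_up' {a b : ℝ} (ha : a < 1/2) (x : ℝ) (hx : x ∈ J a b) (h0 : 0 < x) (h1 : x ≤ a) :
    ∃ y ∈ J a b, 0 < y ∧ y ≤ a ∧ b ≤ Dbl y ∧ ∃ m, y = Dbl^[m] x := by
  obtain ⟨n, hn⟩ := pow_unbounded_of_one_lt (a / x) (by norm_num : (1:ℝ) < 2)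
  exact J_up ha n x hx h0 h1 (by rwa [div_lt_iff₀ h0] at hn)

lemma J_down {a b : ℝ} (hb : 1/2 < b) (n : ℕ) : ∀ x : ℝ, x ∈ J a b → x < 1 → b ≤ x →
    1 - b < 2^n * (1-x) → ∃ y ∈ J a b, y < 1 ∧ b ≤ y ∧ Dbl y ≤ a ∧ ∃ m, y = Dbl^[m] x := by
  induction n with
  | zero => intro x _ _ h1 h2; simp at h2; linarith
  | succ n ih =>
    intro x hx h0 h1 h2
    have hd : Dbl x = 2*x - 1 := dbl_gt (by linarith)
    rcases J_side (J_dbl hx) with h | h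
    · exact ⟨x, hx, h0, h1, h, 0, rfl⟩
    · obtain ⟨y, hy, h3, h4, h5, m, h6⟩ := ih (Dbl x) (J_dbl hx) (by rw [hd]; linarith) h
        (by rw [hd]; rw [pow_succ] at h2; linarith)
      exact ⟨y, hy, h3, h4, h5, m+1, by rw [Function.iterate_succ_apply]; exact h6⟩

lemma J_down' {a b : ℝ} (hb : 1/2 < b) (x : ℝ) (hx : x ∈ J a b) (h0 : x < 1) (h1 : b ≤ x) :
    ∃ y ∈ J a b, y < 1 ∧ b ≤ y ∧ Dbl y ≤ a ∧ ∃ m, y = Dbl^[m] x := by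
  obtain ⟨n, hn⟩ := pow_unbounded_of_one_lt ((1-b) / (1-x)) (by norm_num : (1:ℝ) < 2)
  exact J_down hb n x hx h0 h1 (by rwa [div_lt_iff₀ (by linarith)] at hn)

lemma zero_mem_J {a b : ℝ} (ha : 0 < a) : (0:ℝ) ∈ J a b := by
  refine ⟨by simp, fun n => ?_⟩
  rw [Function.iterate_fixed (by simp [Dbl])]
  intro h; linarith [h.1]

lemma one_mem_J {a b : ℝ} (hb : b < 1) : (1:ℝ) ∈ J a b := by
  refine ⟨by simp, fun n => ?_⟩
  rw [Function.iterate_fixed (by norm_num [Dbl])]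
  intro h; linarith [h.2]

lemma phi_ub {a b : ℝ} (ha : 1/4 < a) (ha' : a < 1/2) (hb : b < 1)
    (hJ : J a b ≠ ({0, 1} : Set ℝ)) : b ≤ a + 1/3 := by
  by_contra hlt
  push Not at hlt
  apply hJ
  ext x
  simp only [Set.mem_insert_iff, Set.mem_singleton_iff]
  constructor
  · intro hx
    by_contra hne
    push Not at hne
    have h0 : 0 < x := lt_of_le_of_ne hx.1.1 (Ne.symm hne.1)
    have h1 : x < 1 := lt_of_le_of_ne hx.1.2 hne.2
    rcases J_side hx with h | h
    · obtain ⟨y, hy, y0, ya, yb, -⟩ := J_up' ha' x hx h0 h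
      have hd : Dbl y = 2*y := dbl_le (by linarith)
      obtain ⟨z, hz, z1, zb, za, -⟩ := J_down' (by linarith) _ (J_dbl hy) (by linarith) yb
      have hd' : Dbl z = 2*z-1 := dbl_gt (by linarith)
      linarith
    · obtain ⟨z, hz, z1, zb, za, -⟩ := J_down' (by linarith) x hx h1 h
      have hd' : Dbl z = 2*z-1 := dbl_gt (by linarith)
      obtain ⟨y, hy, y0, ya, yb, -⟩ := J_up' ha' _ (J_dbl hz) (by linarith) za
      have hd : Dbl y = 2*y := dbl_le (by linarith)
      linarith
  · rintro (rfl | rfl)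
    · exact zero_mem_J (by linarith)
    · exact one_mem_J hb

/-- The trapping part of the survivor set. -/
def Xs (a b : ℝ) : Set ℝ := J a b ∩ Set.Icc (2*b-1) (2*a)

lemma Xs_dbl {a b x : ℝ} (ha' : a < 1/2) (hb : 1/2 < b) (hx : x ∈ Xs a b) :
    Dbl x ∈ Xs a b := by
  obtain ⟨hJ, h1, h2⟩ := hx
  refine ⟨J_dbl hJ, ?_⟩
  rcases J_side hJ with h | h
  · rw [dbl_le (by linarith)]; constructor <;> linarith
  · rw [dbl_gt (by linarith)]; constructor <;> linarith

lemma Xs_contr {a b x y : ℝ} (ha' : a < 1/2) (hb : 1/2 < b) (hx : x ∈ Xs a b)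
    (hy : y ∈ Xs a b) (h : |Dbl x - Dbl y| < 4*(b-a)-1) : |Dbl x - Dbl y| = 2 * |x - y| := by
  have h2 : |(2:ℝ)| = 2 := by norm_num
  rw [abs_lt] at h
  rcases J_side hx.1 with h3 | h3 <;> rcases J_side hy.1 with h4 | h4
  · rw [dbl_le (by linarith), dbl_le (by linarith), ← mul_sub, abs_mul, h2]
  · exfalso
    rw [dbl_le (by linarith : x ≤ 1/2), dbl_gt (by linarith : 1/2 < y)] at h
    linarith [hx.2.1, hy.2.2]
  · exfalso
    rw [dbl_le (by linarith : y ≤ 1/2), dbl_gt (by linarith : 1/2 < x)] at h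
    linarith [hx.2.2, hy.2.1]
  · rw [dbl_gt (by linarith), dbl_gt (by linarith), ← h2, ← abs_mul]
    congr 1; rw [h2]; ring

lemma Xs_contr_iter {a b : ℝ} (ha' : a < 1/2) (hb : 1/2 < b) (n : ℕ) : ∀ x y : ℝ,
    x ∈ Xs a b → y ∈ Xs a b → |Dbl^[n] x - Dbl^[n] y| < 4*(b-a)-1 →
    |x - y| < (4*(b-a)-1) / 2^n := by
  induction n with
  | zero => intro x y _ _ h; simpa using h
  | succ n ih =>
    intro x y hx hy h
    rw [Function.iterate_succ_apply, Function.iterate_succ_apply] at h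
    have h1 := ih _ _ (Xs_dbl ha' hb hx) (Xs_dbl ha' hb hy) h
    have hε : 0 < 4*(b-a)-1 := lt_of_le_of_lt (abs_nonneg _) h
    have h2 : (4*(b-a)-1) / 2^n ≤ 4*(b-a)-1 := div_le_self hε.le (one_le_pow₀ (by norm_num))
    have h3 := Xs_contr ha' hb hx hy (lt_of_lt_of_le h1 h2)
    rw [pow_succ, ← div_div, lt_div_iff₀ (by norm_num)]
    linarith

lemma Xs_finite {a b : ℝ} (ha' : a < 1/2) (hb : 1/2 < b) (hε : 0 < 4*(b-a)-1) :
    (Xs a b).Finite := by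
  set ε := 4*(b-a)-1 with hεd
  by_contra hinf
  have hinf : (Xs a b).Infinite := hinf
  set T : Finset ℤ := Finset.Icc 0 ⌊1/ε⌋ with hT
  obtain ⟨F, hF, hc⟩ := hinf.exists_subset_card_eq (T.card + 1)
  have hev : ∀ᶠ n : ℕ in Filter.atTop, ∀ p ∈ F.offDiag, ε / 2^n < |p.1 - p.2| := by
    rw [Filter.eventually_all_finset]
    intro p hp
    have hne : p.1 - p.2 ≠ 0 := sub_ne_zero.2 (Finset.mem_offDiag.1 hp).2.2
    have ht : Filter.Tendsto (fun n : ℕ => ε / 2^n) Filter.atTop (nhds 0) := by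
      have := (tendsto_pow_atTop_nhds_zero_of_lt_one (by norm_num : (0:ℝ) ≤ 1/2)
        (by norm_num)).const_mul ε
      simpa [div_eq_mul_inv] using this
    exact ht.eventually (gt_mem_nhds (abs_pos.2 hne))
  obtain ⟨n, hn⟩ := hev.exists
  have hmaps : ∀ x ∈ F, ⌊Dbl^[n] x / ε⌋ ∈ T := by
    intro x hx
    have := (J_iter (hF hx).1 n).1
    rw [hT, Finset.mem_Icc]
    refine ⟨Int.floor_nonneg.2 (div_nonneg this.1 hε.le), Int.floor_le_floor ?_⟩
    gcongr; exact this.2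
  obtain ⟨x, hx, y, hy, hxy, hfl⟩ :=
    Finset.exists_ne_map_eq_of_card_lt_of_maps_to (by omega : T.card < F.card) hmaps
  have h1 := Int.abs_sub_lt_one_of_floor_eq_floor hfl
  rw [← sub_div, abs_div, abs_of_pos hε, div_lt_one hε] at h1
  have h2 := Xs_contr_iter ha' hb n x y (hF hx) (hF hy) h1
  have h3 := hn (x, y) (Finset.mem_offDiag.2 ⟨hx, hy, hxy⟩)
  exact lt_asymm h2 h3

lemma countable_pre {S : Set ℝ} (hS : S.Countable) (n : ℕ) : (Dbl^[n] ⁻¹' S).Countable := by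
  induction n with
  | zero => simpa using hS
  | succ n ih =>
    rw [Function.iterate_succ, Set.preimage_comp]
    refine ((ih.image (fun x => x/2)).union (ih.image (fun x => (x+1)/2))).mono ?_
    intro x hx
    rcases le_or_gt x (1/2) with h | h
    · left; refine ⟨Dbl x, hx, ?_⟩; simp only [dbl_le h]; ring
    · right; refine ⟨Dbl x, hx, ?_⟩; simp only [dbl_gt h]; ring

lemma chi_ub {a b : ℝ} (ha : 1/4 < a) (ha' : a < 1/2) (hb : b < 1)
    (hJ : ¬ (J a b).Countable) : b ≤ a + 1/4 := by
  by_contra hlt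
  push Not at hlt
  apply hJ
  have hX := (Xs_finite (a := a) (b := b) ha' (by linarith) (by linarith)).countable
  refine ((Set.countable_iUnion fun n => countable_pre hX n).union
    (Set.Finite.countable (Set.toFinite {(0:ℝ), 1}))).mono ?_
  intro x hx
  by_cases hne : x ∈ ({0, 1} : Set ℝ)
  · right; exact hne
  left
  simp only [Set.mem_insert_iff, Set.mem_singleton_iff, not_or] at hne
  have h0 : 0 < x := lt_of_le_of_ne hx.1.1 (Ne.symm hne.1)
  have h1 : x < 1 := lt_of_le_of_ne hx.1.2 hne.2
  rw [Set.mem_iUnion]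
  rcases J_side hx with h | h
  · obtain ⟨y, hy, y0, ya, yb, m, hm⟩ := J_up' ha' x hx h0 h
    have hd : Dbl y = 2*y := dbl_le (by linarith)
    refine ⟨m+1, ?_⟩
    rw [Set.mem_preimage, Function.iterate_succ_apply', ← hm]
    exact ⟨J_dbl hy, by constructor <;> linarith⟩
  · obtain ⟨z, hz, z1, zb, za, m, hm⟩ := J_down' (by linarith) x hx h1 h
    have hd' : Dbl z = 2*z-1 := dbl_gt (by linarith)
    refine ⟨m+1, ?_⟩
    rw [Set.mem_preimage, Function.iterate_succ_apply', ← hm]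
    exact ⟨J_dbl hz, by constructor <;> linarith⟩

/-- Nested compact sets. -/
def Cs (a b : ℝ) : ℕ → Set ℝ
  | 0 => Set.Icc (2*a-1/2) (2*a)
  | n+1 => (Set.Icc (2*a-1/2) a ∩ (fun x => 2*x) ⁻¹' (Cs a b n)) ∪
      (Set.Icc b (2*a) ∩ (fun x => 2*x-1) ⁻¹' (Cs a b n))

lemma Cs_closed (a b : ℝ) (n : ℕ) : IsClosed (Cs a b n) := by
  induction n with
  | zero => exact isClosed_Icc
  | succ n ih =>
    exact (isClosed_Icc.inter (ih.preimage (by fun_prop))).union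
      (isClosed_Icc.inter (ih.preimage (by fun_prop)))

lemma Cs_sub {a b : ℝ} (ha : 1/4 < a) (ha' : a < 1/2) (hb : 1/2 < b) (n : ℕ) :
    Cs a b n ⊆ Set.Icc (2*a-1/2) (2*a) := by
  cases n with
  | zero => exact subset_rfl
  | succ n =>
    rintro x (⟨h, -⟩ | ⟨h, -⟩)
    · exact ⟨h.1, by linarith [h.1, h.2]⟩
    · exact ⟨by linarith [h.1], h.2⟩

lemma Cs_anti {a b : ℝ} (ha : 1/4 < a) (ha' : a < 1/2) (hb : 1/2 < b) (n : ℕ) :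
    Cs a b (n+1) ⊆ Cs a b n := by
  induction n with
  | zero => exact Cs_sub ha ha' hb 1
  | succ n ih =>
    rintro x (⟨h, h'⟩ | ⟨h, h'⟩)
    · exact Or.inl ⟨h, ih h'⟩
    · exact Or.inr ⟨h, ih h'⟩

lemma Cs_nonempty {a b : ℝ} (ha : 1/4 < a) (ha' : a < 1/2) (hb : 1/2 < b) (hb' : b < a + 1/4)
    (n : ℕ) : (Cs a b n).Nonempty := by
  induction n with
  | zero => exact ⟨2*a, by constructor <;> linarith⟩
  | succ n ih =>
    obtain ⟨y, hy⟩ := ih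
    obtain ⟨h1, h2⟩ := Cs_sub ha ha' hb n hy
    rcases le_or_gt (2*a-1/2) (y/2) with h | h
    · refine ⟨y/2, Or.inl ⟨⟨h, by linarith⟩, ?_⟩⟩
      rw [Set.mem_preimage, mul_div_cancel₀ _ (by norm_num)]; exact hy
    · refine ⟨(y+1)/2, Or.inr ⟨⟨by linarith, by linarith⟩, ?_⟩⟩
      rw [Set.mem_preimage, mul_div_cancel₀ _ (by norm_num), add_sub_cancel_right]; exact hy

lemma Cs_iter {a b : ℝ} (ha' : a < 1/2) (hb : 1/2 < b) (n : ℕ) : ∀ x ∈ Cs a b (n+1),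
    Dbl^[n] x ∉ Set.Ioo a b := by
  induction n with
  | zero =>
    rintro x (⟨h, -⟩ | ⟨h, -⟩) h3
    · have := h3.1; simp at this; linarith [h.2]
    · have := h3.2; simp at this; linarith [h.1]
  | succ n ih =>
    rintro x (⟨h, h'⟩ | ⟨h, h'⟩)
    · rw [Function.iterate_succ_apply, dbl_le (by linarith [h.2])]; exact ih _ h'
    · rw [Function.iterate_succ_apply, dbl_gt (by linarith [h.1])]; exact ih _ h'

lemma phi_exists {a b : ℝ} (ha : 1/4 < a) (ha' : a < 1/2) (hb : 1/2 < b) (hb' : b < a + 1/4) :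
    J a b ≠ ({0, 1} : Set ℝ) := by
  obtain ⟨x, hx⟩ := IsCompact.nonempty_iInter_of_sequence_nonempty_isCompact_isClosed (Cs a b)
    (Cs_anti ha ha' hb) (Cs_nonempty ha ha' hb hb') isCompact_Icc (Cs_closed a b)
  rw [Set.mem_iInter] at hx
  obtain ⟨h1, h2⟩ := hx 0
  have hJ : x ∈ J a b := ⟨⟨by linarith, by linarith⟩, fun n => Cs_iter ha' hb n x (hx (n+1))⟩
  intro he
  rw [he] at hJ
  rcases hJ with h | h
  · linarith
  · rw [Set.mem_singleton_iff] at h; linarith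

/-- Iterated shift. -/
def sh (k : ℕ) (x : ℕ → Bool) : ℕ → Bool := fun n => x (n + k)

lemma sh_zero (x : ℕ → Bool) : sh 0 x = x := rfl
lemma sh_sh (j k : ℕ) (x : ℕ → Bool) : sh j (sh k x) = sh (j + k) x := by
  funext n; simp [sh, add_assoc]

lemma pi_summable (w : ℕ → Bool) :
    Summable (fun n : ℕ => (if w n then (1:ℝ) else 0) / 2 ^ (n+1)) := by
  have hs : Summable (fun n : ℕ => (1:ℝ) / 2 ^ (n+1)) := by
    have := (summable_geometric_of_lt_one (by norm_num : (0:ℝ) ≤ 1/2) (by norm_num))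
    have := (summable_nat_add_iff 1).2 this
    simpa using this
  refine Summable.of_nonneg_of_le (fun n => ?_) (fun n => ?_) hs
  · split_ifs <;> positivity
  · split_ifs
    · exact le_rfl
    · simp only [zero_div]; positivity

lemma pi_cons (w : ℕ → Bool) :
    piMap w = (if w 0 then (1:ℝ) else 0) / 2 + piMap (sh 1 w) / 2 := by
  unfold piMap
  rw [(pi_summable w).tsum_eq_zero_add, ← tsum_div_const]
  congr 1
  · simp
  · refine tsum_congr fun n => ?_
    simp only [sh]
    rw [div_div, ← pow_succ]
    rfl

lemma pi_nonneg (w : ℕ → Bool) : 0 ≤ piMap w :=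
  tsum_nonneg fun n => by split_ifs <;> positivity

lemma pi_le_one (w : ℕ → Bool) : piMap w ≤ 1 := by
  have hs : HasSum (fun n : ℕ => (1:ℝ) / 2 ^ (n+1)) 1 := by
    have := hasSum_geometric_two' (1:ℝ)
    convert this using 2 with n
    rw [pow_succ, div_div, mul_comm]
  rw [← hs.tsum_eq]
  refine (pi_summable w).tsum_le_tsum (fun n => ?_) hs.summable
  gcongr; split_ifs <;> norm_num

lemma pi_false {w : ℕ → Bool} (h : w 0 = false) : piMap w = piMap (sh 1 w) / 2 := by
  rw [pi_cons w]; simp [h]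
lemma pi_true {w : ℕ → Bool} (h : w 0 = true) : piMap w = 1/2 + piMap (sh 1 w) / 2 := by
  rw [pi_cons w]; simp [h]

lemma pi_mono_lt (n : ℕ) : ∀ u v : ℕ → Bool, (∀ i < n, u i = v i) → u n < v n →
    piMap u ≤ piMap v := by
  induction n with
  | zero =>
    intro u v _ h
    have hu : u 0 = false := by revert h; cases u 0 <;> simp
    have hv : v 0 = true := by revert h; cases v 0 <;> simp
    rw [pi_false hu, pi_true hv]
    linarith [pi_le_one (sh 1 u), pi_nonneg (sh 1 v)]
  | succ n ih =>
    intro u v h1 h2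
    have := ih (sh 1 u) (sh 1 v) (fun i hi => h1 (i+1) (by omega)) h2
    rw [pi_cons u, pi_cons v, h1 0 (by omega)]
    linarith

lemma pi_mono {u v : ℕ → Bool} (h : seqLe u v) : piMap u ≤ piMap v := by
  rcases h with ⟨n, h1, h2⟩ | rfl
  · exact pi_mono_lt n u v h1 h2
  · exact le_rfl

lemma pi_close (n : ℕ) : ∀ u v : ℕ → Bool, (∀ i < n, u i = v i) →
    piMap u ≤ piMap v + 1 / 2^n := by
  induction n with
  | zero => intro u v _; simp; linarith [pi_le_one u, pi_nonneg v]
  | succ n ih =>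
    intro u v h1
    have := ih (sh 1 u) (sh 1 v) (fun i hi => h1 (i+1) (by omega))
    rw [pi_cons u, pi_cons v, h1 0 (by omega), pow_succ, ← div_div]
    linarith

lemma seqLe_of_pointwise {u v : ℕ → Bool} (h : ∀ i, u i ≤ v i) : seqLe u v := by
  by_cases he : u = v
  · exact Or.inr he
  · left
    have hex : ∃ n, u n ≠ v n := by
      by_contra hc; push Not at hc; exact he (funext hc)
    classical
    refine ⟨Nat.find hex, fun i hi => ?_, lt_of_le_of_ne (h _) (Nat.find_spec hex)⟩
    by_contra hc
    exact Nat.find_min hex hi hc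

/-- Sequences whose orbit codes avoid the hole `(a,b)`. -/
def Good (a b : ℝ) (x : ℕ → Bool) : Prop :=
  ∀ k, (x k = false → piMap (sh k x) ∉ Set.Ioo a b) ∧
    (x k = true → 1/2 < piMap (sh k x) ∧ piMap (sh k x) ∉ Set.Ioo a b)

lemma good_iter {a b : ℝ} {x : ℕ → Bool} (h : Good a b x) (k : ℕ) :
    Dbl^[k] (piMap x) = piMap (sh k x) := by
  induction k with
  | zero => rfl
  | succ k ih =>
    rw [Function.iterate_succ_apply', ih]
    have hs : sh 1 (sh k x) = sh (k+1) x := by rw [sh_sh, add_comm]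
    have h0 : (sh k x) 0 = x k := by simp [sh]
    cases hx : x k
    · have e := pi_false (h0.trans hx)
      rw [hs] at e
      rw [dbl_le (by linarith [pi_le_one (sh (k+1) x)])]; linarith
    · have e := pi_true (h0.trans hx)
      rw [hs] at e
      rw [dbl_gt ((h k).2 hx).1]; linarith

lemma good_mem {a b : ℝ} {x : ℕ → Bool} (h : Good a b x) : piMap x ∈ J a b := by
  refine ⟨⟨pi_nonneg x, pi_le_one x⟩, fun k => ?_⟩
  rw [good_iter h k]
  cases hx : x k
  · exact (h k).1 hx
  · exact ((h k).2 hx).2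

lemma good_bit {a b : ℝ} {x : ℕ → Bool} (h : Good a b x) (k : ℕ) :
    x k = true ↔ 1/2 < Dbl^[k] (piMap x) := by
  rw [good_iter h k]
  refine ⟨fun hx => ((h k).2 hx).1, fun hlt => ?_⟩
  by_contra hx
  have h0 : (sh k x) 0 = false := by simpa [sh] using hx
  have e := pi_false h0
  linarith [pi_le_one (sh 1 (sh k x))]

lemma good_inj {a b : ℝ} {x y : ℕ → Bool} (hx : Good a b x) (hy : Good a b y)
    (h : piMap x = piMap y) : x = y := by
  funext k
  rw [Bool.eq_iff_iff, good_bit hx, good_bit hy, h]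

lemma not_countable_of_good {a b : ℝ} (f : (ℕ → Bool) → (ℕ → Bool))
    (hf : Function.Injective f) (hg : ∀ w, Good a b (f w)) : ¬ (J a b).Countable := by
  have h4 : Cardinal.mk (ℕ → Bool) = 2 ^ Cardinal.aleph0 := by simp
  intro hc
  have hinj : Function.Injective (fun w => piMap (f w)) := fun w w' h =>
    hf (good_inj (hg w) (hg w') h)
  have h1 := hc.preimage_of_injOn (f := fun w => piMap (f w)) hinj.injOn
  have h2 : (fun w => piMap (f w)) ⁻¹' (J a b) = Set.univ :=
    Set.eq_univ_of_forall fun w => good_mem (hg w)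
  rw [h2, Set.countable_univ_iff] at h1
  have h3 : Cardinal.mk (ℕ → Bool) ≤ Cardinal.aleph0 := Cardinal.mk_le_aleph0_iff.2 h1
  rw [h4] at h3
  exact absurd (Cardinal.cantor Cardinal.aleph0) (not_lt.2 h3)

/-- Admissible sequences for a symbolic hole. -/
def Adm (A B x : ℕ → Bool) : Prop :=
  ∀ k, (x k = false → seqLe (sh k x) A) ∧ (x k = true → seqLe B (sh k x))

lemma Adm.good {A B x : ℕ → Bool} (h : Adm A B x) {a b : ℝ} (hA : piMap A ≤ a)
    (hB : b ≤ piMap B) (hB' : 1/2 < piMap B) : Good a b x := by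
  intro k
  refine ⟨fun hx hm => ?_, fun hx => ⟨?_, fun hm => ?_⟩⟩
  · have := pi_mono ((h k).1 hx); linarith [hm.1]
  · have := pi_mono ((h k).2 hx); linarith
  · have := pi_mono ((h k).2 hx); linarith [hm.2]

/-- The Thue-Morse substitution. -/
def tm (x : ℕ → Bool) : ℕ → Bool := fun n => if n % 2 = 0 then x (n/2) else !(x (n/2))

lemma tm_even (x : ℕ → Bool) (n : ℕ) : tm x (2*n) = x n := by simp [tm]
lemma tm_odd (x : ℕ → Bool) (n : ℕ) : tm x (2*n+1) = !(x n) := by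
  have h1 : (2*n+1) % 2 = 1 := by omega
  have h2 : (2*n+1) / 2 = n := by omega
  simp [tm, h1, h2]

lemma tm_inj : Function.Injective tm := by
  intro x y h; funext n; rw [← tm_even x, ← tm_even y, h]

lemma tm_mono {u v : ℕ → Bool} (h : seqLe u v) : seqLe (tm u) (tm v) := by
  rcases h with ⟨n, h1, h2⟩ | rfl
  · left
    refine ⟨2*n, fun i hi => ?_, by rwa [tm_even, tm_even]⟩
    simp only [tm]; rw [h1 (i/2) (by omega)]
  · exact Or.inr rfl

lemma tm_sh (m : ℕ) (x : ℕ → Bool) : sh (2*m) (tm x) = tm (sh m x) := by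
  funext n
  have h1 : (n + 2*m) % 2 = n % 2 := by omega
  have h2 : (n + 2*m) / 2 = n/2 + m := by omega
  simp [tm, sh, h1, h2]

lemma tm_adm {A B x : ℕ → Bool} (h : Adm A B x) (hA0 : A 0 = false) (hA1 : A 1 = true)
    (hB0 : B 0 = true) (hB1 : B 1 = false) : Adm (tm A) (tm B) (tm x) := by
  have tA0 : tm A 0 = false := by simpa [hA0] using tm_even A 0
  have tA1 : tm A 1 = true := by simpa [hA0] using tm_odd A 0
  have tA2 : tm A 2 = true := by simpa [hA1] using tm_even A 1
  have tB0 : tm B 0 = true := by simpa [hB0] using tm_even B 0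
  have tB1 : tm B 1 = false := by simpa [hB0] using tm_odd B 0
  have tB2 : tm B 2 = false := by simpa [hB1] using tm_even B 1
  intro k
  obtain ⟨m, rfl | rfl⟩ : ∃ m, k = 2*m ∨ k = 2*m+1 := ⟨k/2, by omega⟩
  · rw [tm_sh, tm_even]
    exact ⟨fun hx => tm_mono ((h m).1 hx), fun hx => tm_mono ((h m).2 hx)⟩
  · have e0 : sh (2*m+1) (tm x) 0 = tm x (2*m+1) := by simp [sh]
    have e1 : sh (2*m+1) (tm x) 1 = x (m+1) := by
      rw [← tm_even x (m+1)]; simp only [sh]; congr 1; ring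
    have e2 : sh (2*m+1) (tm x) 2 = !(x (m+1)) := by
      rw [← tm_odd x (m+1)]; simp only [sh]; congr 1; ring
    constructor
    · intro hx
      left
      cases hc : x (m+1)
      · refine ⟨1, fun i hi => ?_, ?_⟩
        · obtain rfl : i = 0 := by omega
          rw [e0, tA0, hx]
        · rw [e1, tA1, hc]; decide
      · refine ⟨2, fun i hi => ?_, ?_⟩
        · obtain rfl | rfl : i = 0 ∨ i = 1 := by omega
          · rw [e0, tA0, hx]
          · rw [e1, tA1, hc]
        · rw [e2, tA2, hc]; decide
    · intro hx
      left
      cases hc : x (m+1)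
      · refine ⟨2, fun i hi => ?_, ?_⟩
        · obtain rfl | rfl : i = 0 ∨ i = 1 := by omega
          · rw [e0, tB0, hx]
          · rw [e1, tB1, hc]
        · rw [e2, tB2, hc]; decide
      · refine ⟨1, fun i hi => ?_, ?_⟩
        · obtain rfl : i = 0 := by omega
          rw [e0, tB0, hx]
        · rw [e1, tB1, hc]; decide

lemma tm_start {A : ℕ → Bool} {c : Bool} (h0 : A 0 = c) :
    tm A 0 = c ∧ tm A 1 = !c := by
  constructor
  · simpa [h0] using tm_even A 0
  · simpa [h0] using tm_odd A 0

lemma tm_iter_adm {A B x : ℕ → Bool} (h : Adm A B x) (hA0 : A 0 = false) (hA1 : A 1 = true)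
    (hB0 : B 0 = true) (hB1 : B 1 = false) (m : ℕ) :
    Adm (tm^[m] A) (tm^[m] B) (tm^[m] x) := by
  induction m generalizing A B x with
  | zero => exact h
  | succ m ih =>
    simp only [Function.iterate_succ_apply]
    exact ih (tm_adm h hA0 hA1 hB0 hB1) (tm_start hA0).1 (tm_start hA0).2
      (tm_start hB0).1 (tm_start hB0).2

lemma tm_agree {u v : ℕ → Bool} {N : ℕ} (h : ∀ i < N, u i = v i) (m : ℕ) :
    ∀ i < N, tm^[m] u i = tm^[m] v i := by
  induction m with
  | zero => exact h
  | succ m ih =>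
    intro i hi
    rw [Function.iterate_succ_apply', Function.iterate_succ_apply']
    simp only [tm]; rw [ih (i/2) (by omega)]

/-- Signed generating function. -/
def Gf (x : ℕ → Bool) (z : ℝ) : ℝ := ∑' n : ℕ, (if x n then (-1:ℝ) else 1) * z ^ n

lemma Gf_summable (x : ℕ → Bool) {z : ℝ} (h0 : 0 ≤ z) (h1 : z < 1) :
    Summable (fun n : ℕ => (if x n then (-1:ℝ) else 1) * z ^ n) := by
  refine Summable.of_norm_bounded (summable_geometric_of_lt_one h0 h1) fun n => ?_
  rw [norm_mul, norm_pow, Real.norm_of_nonneg h0]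
  split_ifs <;> simp

lemma Gf_cons (x : ℕ → Bool) {z : ℝ} (h0 : 0 ≤ z) (h1 : z < 1) :
    Gf x z = (if x 0 then (-1:ℝ) else 1) + z * Gf (sh 1 x) z := by
  unfold Gf
  rw [(Gf_summable x h0 h1).tsum_eq_zero_add, ← tsum_mul_left]
  congr 1
  · simp
  · refine tsum_congr fun n => ?_
    simp only [sh]; ring

lemma Gf_tm (x : ℕ → Bool) {z : ℝ} (h0 : 0 ≤ z) (h1 : z < 1) :
    Gf (tm x) z = (1 - z) * Gf x (z^2) := by
  have hz : z^2 < 1 := by nlinarith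
  have hs := Gf_summable (tm x) h0 h1
  unfold Gf
  have e := tsum_even_add_odd (f := fun n : ℕ => (if tm x n then (-1:ℝ) else 1) * z ^ n)
    (hs.comp_injective (i := fun k => 2*k) (fun a b h => by simpa using h))
    (hs.comp_injective (i := fun k => 2*k+1) (fun a b h => by simpa using h))
  rw [← e, sub_mul, one_mul, sub_eq_add_neg, ← tsum_mul_left, ← tsum_neg]
  congr 1
  · refine tsum_congr fun n => ?_
    simp only [tm_even, pow_mul]
  · refine tsum_congr fun n => ?_
    simp only [tm_odd, pow_add, pow_mul, pow_one]
    cases x n <;> simp <;> ring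

lemma pi_eq_Gf (x : ℕ → Bool) : piMap x = 1/2 - Gf x (1/2) / 4 := by
  have hg : HasSum (fun n : ℕ => (1:ℝ)/4 * (1/2)^n) (1/4 * 2) := hasSum_geometric_two.mul_left _
  have h2 := ((Gf_summable x (by norm_num : (0:ℝ) ≤ 1/2) (by norm_num)).hasSum).mul_left (1/4)
  have h3 := hg.sub h2
  unfold piMap
  rw [show (fun n : ℕ => (if x n then (1:ℝ) else 0) / 2 ^ (n+1)) = fun n : ℕ =>
    (1:ℝ)/4 * (1/2)^n - 1/4 * ((if x n then (-1:ℝ) else 1) * (1/2)^n) from ?_, h3.tsum_eq]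
  · unfold Gf; ring
  · funext n
    rw [pow_succ, one_div_pow]
    cases x n
    · simp
    · simp; ring_nf

/-- Partial products. -/
def Pm (m : ℕ) : ℝ := ∏ j ∈ Finset.range m, (1 - (1/2 : ℝ) ^ 2 ^ j)

lemma Gf_iter (x : ℕ → Bool) (m : ℕ) :
    Gf (tm^[m] x) (1/2) = Pm m * Gf x ((1/2)^2^m) := by
  induction m generalizing x with
  | zero => simp [Pm]
  | succ m ih =>
    rw [Function.iterate_succ_apply, ih, Gf_tm _ (by positivity)
      (pow_lt_one₀ (by norm_num) (by norm_num) (by positivity))]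
    rw [Pm, Pm, Finset.prod_range_succ, pow_succ 2 m, pow_mul]; ring_nf

/-- `(01)^∞`. -/
def A0 : ℕ → Bool := fun n => decide (n % 2 = 1)
/-- `10(01)^∞`. -/
def B0 : ℕ → Bool := fun n => if n = 0 then true else if n = 1 then false else decide (n % 2 = 1)

lemma Gf_A0 {z : ℝ} (h0 : 0 ≤ z) (h1 : z < 1) : Gf A0 z = 1 / (1 + z) := by
  have e : sh 1 (sh 1 A0) = A0 := by
    funext n; simp only [sh, A0]
    have : (n+1+1) % 2 = n % 2 := by omega
    rw [this]
  have e1 := Gf_cons A0 h0 h1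
  have e2 := Gf_cons (sh 1 A0) h0 h1
  rw [e] at e2
  rw [e2] at e1
  simp [A0, sh] at e1
  have hz : (1 - z) * (1+z) ≠ 0 := by
    apply ne_of_gt; apply mul_pos <;> linarith
  rw [eq_div_iff (by linarith)]
  have h2 : (1 - z) * (Gf A0 z * (1 + z) - 1) = 0 := by
    linear_combination e1
  rcases mul_eq_zero.1 h2 with h | h
  · linarith
  · linarith

lemma Gf_B0 {z : ℝ} (h0 : 0 ≤ z) (h1 : z < 1) : Gf B0 z = (2*z^2-1) / (1 + z) := by
  have e : sh 1 (sh 1 B0) = A0 := by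
    funext n; simp [sh, A0, B0]
    have : (n+1+1) % 2 = n % 2 := by omega
    rw [this]
  have e1 := Gf_cons B0 h0 h1
  have e2 := Gf_cons (sh 1 B0) h0 h1
  rw [e, Gf_A0 h0 h1] at e2
  rw [e2] at e1
  rw [e1]
  have : 1 + z ≠ 0 := by linarith
  simp [B0, sh]
  field_simp
  ring

/-- Concatenation of equal length blocks. -/
def fam (L : ℕ) (f : Bool → ℕ → Bool) (w : ℕ → Bool) : ℕ → Bool := fun n => f (w (n / L)) (n % L)

lemma fam_at (L : ℕ) (f : Bool → ℕ → Bool) (w : ℕ → Bool) {k i r : ℕ} (hr : r < L)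
    (hk : k = L*i + r) : fam L f w k = f (w i) r := by
  have h1 : k / L = i := by
    rw [hk, Nat.mul_add_div (by omega), Nat.div_eq_of_lt hr, add_zero]
  have h2 : k % L = r := by
    rw [hk, Nat.mul_add_mod, Nat.mod_eq_of_lt hr]
  simp [fam, h1, h2]

lemma fam_inj {L : ℕ} {f : Bool → ℕ → Bool} {p : ℕ} (hp : p < L) (h : ∀ c, f c p = c) :
    Function.Injective (fam L f) := by
  intro w w' e
  funext i
  have := congrFun e (L*i+p)
  rwa [fam_at L f w hp rfl, fam_at L f w' hp rfl, h, h] at this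

/-- Blocks for the main family. -/
def fM (c : Bool) (r : ℕ) : Bool :=
  if r = 0 then false else if r = 1 then c else if r = 2 then !c else decide (r % 2 = 0)

lemma fM_ge {c : Bool} {r : ℕ} (h : 3 ≤ r) : fM c r = decide (r % 2 = 0) := by
  unfold fM; rw [if_neg (by omega), if_neg (by omega), if_neg (by omega)]

/-- Lower symbolic bound for the main family. -/
def BL (M : ℕ) : ℕ → Bool := fun n =>
  if n = 0 then true else if n = 1 then false else decide (n % 2 = 1 ∧ n < 2*M)

lemma exists_pos (L : ℕ) (hL : 0 < L) (k : ℕ) : ∃ i r, r < L ∧ k = L*i + r :=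
  ⟨k / L, k % L, Nat.mod_lt _ hL, (Nat.div_add_mod k L).symm⟩

lemma fam_no11 {M : ℕ} (hM : 2 ≤ M) (w : ℕ → Bool) (k : ℕ)
    (h : fam (2*M+1) fM w k = true) : fam (2*M+1) fM w (k+1) = false := by
  obtain ⟨i, r, hr, hk⟩ := exists_pos (2*M+1) (by omega) k
  rw [fam_at _ fM w hr hk] at h
  rcases Nat.lt_or_ge (r+1) (2*M+1) with h1 | h1
  · rw [fam_at _ fM w h1 (by omega : k+1 = (2*M+1)*i + (r+1))]
    rcases Nat.lt_or_ge r 3 with h2 | h2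
    · interval_cases r
      · simp [fM] at h
      · simp [fM] at h; simp [fM, h]
      · simp [fM]
    · rw [fM_ge h2] at h
      rw [fM_ge (by omega)]
      simp at h ⊢; omega
  · rw [fam_at _ fM w (by omega : 0 < 2*M+1) (i := i+1) (by rw [mul_add]; omega)]
    simp [fM]

lemma le_A0_of_no11 {x : ℕ → Bool} (h : ∀ k, x k = true → x (k+1) = false) (k : ℕ)
    (hk : x k = false) : seqLe (sh k x) A0 := by
  by_cases he : sh k x = A0
  · exact Or.inr he
  · left
    have hex : ∃ n, sh k x n ≠ A0 n := by
      by_contra hc; push Not at hc; exact he (funext hc)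
    classical
    have hmin : ∀ i < Nat.find hex, sh k x i = A0 i := by
      intro i hi
      by_contra hc
      exact Nat.find_min hex hi hc
    refine ⟨Nat.find hex, hmin, ?_⟩
    have hs := Nat.find_spec hex
    generalize Nat.find hex = n at *
    rcases Nat.even_or_odd' n with ⟨j, rfl | rfl⟩
    · exfalso
      have h0 : A0 (2*j) = false := by simp [A0]
      rw [h0] at hs
      rcases j with _ | j
      · apply hs; simpa [sh] using hk
      · have h1 := hmin (2*j+1) (by omega)
        have h2 : A0 (2*j+1) = true := by simp [A0]
        rw [h2] at h1
        apply hs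
        have := h _ h1
        simp only [sh]
        rw [← this]; congr 1; ring
    · have h0 : A0 (2*j+1) = true := by simp [A0]
      rw [h0] at hs ⊢
      have hs : sh k x (2*j+1) = false := by simpa using hs
      rw [hs]; decide

lemma fam_adm {M : ℕ} (hM : 2 ≤ M) (w : ℕ → Bool) : Adm A0 (BL M) (fam (2*M+1) fM w) := by
  have hno := fam_no11 hM w
  intro k
  refine ⟨le_A0_of_no11 hno k, fun hx => ?_⟩
  have lt2 : fam (2*M+1) fM w (k+2) = true → seqLe (BL M) (sh k (fam (2*M+1) fM w)) := by
    intro h2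
    left
    refine ⟨2, fun j hj => ?_, ?_⟩
    · obtain rfl | rfl : j = 0 ∨ j = 1 := by omega
      · simp [BL, sh, hx]
      · have := hno k hx
        rw [add_comm k] at this
        simp [BL, sh, this]
    · rw [add_comm k] at h2
      simp [BL, sh, h2]
  have pw : (∀ n, 3 ≤ n → n % 2 = 1 → n < 2*M → fam (2*M+1) fM w (k+n) = true) →
      seqLe (BL M) (sh k (fam (2*M+1) fM w)) := by
    intro h
    apply seqLe_of_pointwise
    intro n
    rcases Nat.lt_or_ge n 3 with h3 | h3
    · interval_cases n
      · simp [BL, sh, hx]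
      · simp [BL]
      · simp [BL]
    · by_cases hc : n % 2 = 1 ∧ n < 2*M
      · have := h n h3 hc.1 hc.2
        rw [add_comm k] at this
        simp [sh, this]
      · have : BL M n = false := by
          unfold BL; rw [if_neg (by omega), if_neg (by omega)]; simpa using hc
        rw [this]; exact Bool.false_le _
  obtain ⟨i, r, hr, hk⟩ := exists_pos (2*M+1) (by omega) k
  have hx' := hx
  rw [fam_at _ fM w hr hk] at hx'
  rcases Nat.lt_or_ge r 2 with h1 | h1
  · have hr1 : r = 1 := by
      interval_cases r
      · simp [fM] at hx'
      · rfl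
    apply pw
    intro n h3 h4 h5
    rw [fam_at _ fM w (by omega : 1 + n < 2*M+1) (by omega : k+n = (2*M+1)*i + (1+n)),
      fM_ge (by omega)]
    simp; omega
  · have heven : r % 2 = 0 := by
      rcases Nat.lt_or_ge r 3 with h2 | h2
      · omega
      · rw [fM_ge h2] at hx'; simpa using hx'
    rcases Nat.lt_or_ge (r+2) (2*M+1) with h2 | h2
    · apply lt2
      rw [fam_at _ fM w h2 (by omega : k+2 = (2*M+1)*i + (r+2)), fM_ge (by omega)]
      simp; omega
    · have hr2 : r = 2*M := by omega
      cases hc : w (i+1)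
      · apply pw
        intro n h3 h4 h5
        rw [fam_at _ fM w (by omega : n-1 < 2*M+1) (i := i+1) (by rw [mul_add]; omega)]
        rcases Nat.lt_or_ge n 4 with h6 | h6
        · obtain rfl : n = 3 := by omega
          simp [fM, hc]
        · rw [fM_ge (by omega)]; simp; omega
      · apply lt2
        rw [fam_at _ fM w (by omega : 1 < 2*M+1) (i := i+1) (by rw [mul_add]; omega)]
        simp [fM, hc]

/-- Left end points. -/
def al (m : ℕ) : ℝ := 1/2 - Pm m / (4 * (1 + (1/2)^2^m))
/-- Right end points. -/
def be (m : ℕ) : ℝ := 1/2 + Pm m * (1 - 2 * ((1/2)^2^m)^2) / (4 * (1 + (1/2)^2^m))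

lemma zm_pos (m : ℕ) : (0:ℝ) < (1/2)^2^m := by positivity
lemma zm_le (m : ℕ) : ((1:ℝ)/2)^2^m ≤ 1/2 := by
  calc ((1:ℝ)/2)^2^m ≤ (1/2)^1 :=
        pow_le_pow_of_le_one (by norm_num) (by norm_num) Nat.one_le_two_pow
    _ = 1/2 := by norm_num

lemma Pm_pos (m : ℕ) : 0 < Pm m := by
  apply Finset.prod_pos
  intro j _
  linarith [zm_le j]

lemma Pm_succ (m : ℕ) : Pm (m+1) = Pm m * (1 - (1/2)^2^m) := by
  simp [Pm, Finset.prod_range_succ]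

lemma pi_A (m : ℕ) : piMap (tm^[m] A0) = al m := by
  have := zm_pos m
  have h2 := zm_le m
  rw [pi_eq_Gf, Gf_iter, Gf_A0 (by positivity) (by linarith), al]
  field_simp

lemma pi_B (m : ℕ) : piMap (tm^[m] B0) = be m := by
  have := zm_pos m
  have h2 := zm_le m
  rw [pi_eq_Gf, Gf_iter, Gf_B0 (by positivity) (by linarith), be]
  field_simp
  ring

lemma be_gt (m : ℕ) : 1/2 < be m := by
  have h1 := zm_pos m
  have h2 := zm_le m
  have h3 := Pm_pos m
  unfold be
  have : 0 < Pm m * (1 - 2 * ((1/2)^2^m)^2) / (4 * (1 + (1/2)^2^m)) := by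
    apply div_pos
    · apply mul_pos h3; nlinarith
    · positivity
  linarith

lemma main_unc (m : ℕ) {b : ℝ} (hb : b < be m) : ¬ (J (al m) b).Countable := by
  set b' := max b (1/2) with hb'
  have hlt : b' < be m := max_lt hb (be_gt m)
  obtain ⟨n, hn⟩ := exists_pow_lt_of_lt_one (sub_pos.2 hlt) (by norm_num : (1:ℝ)/2 < 1)
  set M := n + 2 with hM
  have hclose := pi_close (2*M) (tm^[m] B0) (tm^[m] (BL M)) (tm_agree (by
    intro i hi
    simp [B0, BL, hi]) m)
  have hsm : (1:ℝ) / 2^(2*M) ≤ (1/2)^n := by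
    rw [← one_div_pow]
    exact pow_le_pow_of_le_one (by norm_num) (by norm_num) (by omega)
  rw [pi_B] at hclose
  have hBL : b' < piMap (tm^[m] (BL M)) := by linarith
  refine not_countable_of_good (fun w => tm^[m] (fam (2*M+1) fM w))
    ((tm_inj.iterate m).comp (fam_inj (p := 1) (by omega) (by intro c; simp [fM]))) ?_
  intro w
  refine (tm_iter_adm (fam_adm (by omega) w) (by simp [A0]) (by simp [A0]) (by simp [BL])
    (by simp [BL]) m).good (pi_A m).le ?_ ?_
  · exact (le_max_left _ _).trans hBL.le
  · exact lt_of_le_of_lt (le_max_right _ _) hBL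

/-- Blocks, first special family. -/
def f1 (c : Bool) (r : ℕ) : Bool :=
  if r = 0 then false else if r = 5 then c else if r = 6 then !c else true

/-- Blocks, second special family. -/
def f2 (c : Bool) (r : ℕ) : Bool :=
  if r = 0 then true else if r = 4 then c else if r = 5 then !c else false

lemma sp1_fact (w : ℕ → Bool) (k : ℕ) (h : fam 11 f1 w k = false) :
    fam 11 f1 w (k+1) = true ∧ fam 11 f1 w (k+2) = true ∧ fam 11 f1 w (k+3) = true ∧
    fam 11 f1 w (k+4) = true := by
  obtain ⟨i, r, hr, hk⟩ := exists_pos 11 (by omega) k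
  rw [fam_at _ f1 w hr hk] at h
  have e : ∀ j, r + j < 11 → fam 11 f1 w (k+j) = f1 (w i) (r+j) := fun j hj =>
    fam_at _ _ _ hj (by omega)
  have hc : r = 0 ∨ (r = 5 ∧ w i = false) ∨ (r = 6 ∧ w i = true) := by
    interval_cases r <;> simp_all [f1]
  rcases hc with rfl | ⟨rfl, hw⟩ | ⟨rfl, hw⟩
  · rw [e 1 (by omega), e 2 (by omega), e 3 (by omega), e 4 (by omega)]; simp [f1]
  · rw [e 1 (by omega), e 2 (by omega), e 3 (by omega), e 4 (by omega)]; simp [f1, hw]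
  · rw [e 1 (by omega), e 2 (by omega), e 3 (by omega), e 4 (by omega)]; simp [f1]

lemma sp2_fact (w : ℕ → Bool) (k : ℕ) (h : fam 9 f2 w k = true) :
    fam 9 f2 w (k+1) = false ∧ fam 9 f2 w (k+2) = false ∧ fam 9 f2 w (k+3) = false ∧
    (fam 9 f2 w (k+4) = true ∨ fam 9 f2 w (k+5) = true) := by
  obtain ⟨i, r, hr, hk⟩ := exists_pos 9 (by omega) k
  rw [fam_at _ f2 w hr hk] at h
  have e : ∀ j, r + j < 9 → fam 9 f2 w (k+j) = f2 (w i) (r+j) := fun j hj =>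
    fam_at _ _ _ hj (by omega)
  have e0 : ∀ j, r + j = 9 → fam 9 f2 w (k+j) = true := fun j hj => by
    rw [fam_at 9 f2 w (by omega : 0 < 9) (i := i+1) (by omega)]; simp [f2]
  have hc : r = 0 ∨ (r = 5 ∧ w i = false) ∨ (r = 4 ∧ w i = true) := by
    interval_cases r <;> simp_all [f2]
  rcases hc with rfl | ⟨rfl, hw⟩ | ⟨rfl, hw⟩
  · rw [e 1 (by omega), e 2 (by omega), e 3 (by omega), e 4 (by omega), e 5 (by omega)]
    cases w i <;> simp [f2]
  · rw [e 1 (by omega), e 2 (by omega), e 3 (by omega), e0 4 (by omega)]; simp [f2]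
  · rw [e 1 (by omega), e 2 (by omega), e 3 (by omega), e0 5 (by omega)]; simp [f2, hw]

lemma pi_sh_false {x : ℕ → Bool} {k : ℕ} (h : x k = false) :
    piMap (sh k x) = piMap (sh (k+1) x) / 2 := by
  rw [pi_false (w := sh k x) (by simpa [sh] using h), sh_sh, add_comm 1 k]
lemma pi_sh_true {x : ℕ → Bool} {k : ℕ} (h : x k = true) :
    piMap (sh k x) = 1/2 + piMap (sh (k+1) x) / 2 := by
  rw [pi_true (w := sh k x) (by simpa [sh] using h), sh_sh, add_comm 1 k]

lemma sp1_unc : ¬ (J (1/4) (15/32)).Countable := by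
  refine not_countable_of_good (fam 11 f1) (fam_inj (p := 5) (by omega) (by simp [f1])) ?_
  intro w k
  have H0 : ∀ k, fam 11 f1 w k = false → 15/32 ≤ piMap (sh k (fam 11 f1 w)) := by
    intro k hx
    obtain ⟨h1, h2, h3, h4⟩ := sp1_fact w k hx
    rw [pi_sh_false hx, pi_sh_true h1, pi_sh_true h2, pi_sh_true h3, pi_sh_true h4]
    linarith [pi_nonneg (sh (k+4+1) (fam 11 f1 w))]
  have H1 : fam 11 f1 w k = true → 1/2 < piMap (sh k (fam 11 f1 w)) := by
    intro hx
    rw [pi_sh_true hx]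
    cases h : fam 11 f1 w (k+1)
    · linarith [H0 _ h]
    · rw [pi_sh_true h]; linarith [pi_nonneg (sh (k+1+1) (fam 11 f1 w))]
  refine ⟨fun hx hm => ?_, fun hx => ⟨H1 hx, fun hm => ?_⟩⟩
  · linarith [H0 k hx, hm.2]
  · linarith [H1 hx, hm.2]

lemma sp2_unc : ¬ (J (9/32) (33/64)).Countable := by
  refine not_countable_of_good (fam 9 f2) (fam_inj (p := 4) (by omega) (by simp [f2])) ?_
  intro w k
  have H1 : fam 9 f2 w k = true → 33/64 ≤ piMap (sh k (fam 9 f2 w)) := by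
    intro hx
    obtain ⟨h1, h2, h3, h4⟩ := sp2_fact w k hx
    rw [pi_sh_true hx, pi_sh_false h1, pi_sh_false h2, pi_sh_false h3]
    rcases h4 with h | h
    · have := pi_sh_true h
      linarith [pi_nonneg (sh (k+4+1) (fam 9 f2 w))]
    · have := pi_sh_true h
      have h5 := pi_nonneg (sh (k+5+1) (fam 9 f2 w))
      cases h6 : fam 9 f2 w (k+4)
      · have := pi_sh_false h6; linarith
      · have := pi_sh_true h6; linarith
  have H0 : fam 9 f2 w k = false → piMap (sh k (fam 9 f2 w)) ≤ 9/32 := by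
    intro hx
    rw [pi_sh_false hx]
    cases h : fam 9 f2 w (k+1)
    · rw [pi_sh_false h]; linarith [pi_le_one (sh (k+1+1) (fam 9 f2 w))]
    · obtain ⟨h1, h2, h3, h4⟩ := sp2_fact w _ h
      rw [pi_sh_true h, pi_sh_false h1, pi_sh_false h2, pi_sh_false h3]
      linarith [pi_le_one (sh (k+1+3+1) (fam 9 f2 w))]
  refine ⟨fun hx hm => ?_, fun hx => ⟨?_, fun hm => ?_⟩⟩
  · linarith [H0 hx, hm.1]
  · linarith [H1 hx]
  · linarith [H1 hx, hm.2]

/-- The constant of the theorem. -/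
def cc : ℝ := (1/4) * (∏' j : ℕ, (1 - (2:ℝ)⁻¹ ^ 2 ^ (j+1)))

lemma Pm_quarter (n : ℕ) :
    (1/4) * ∏ j ∈ Finset.range n, (1 - (2:ℝ)⁻¹ ^ 2 ^ (j+1)) = Pm (n+1) / 2 := by
  rw [Pm, Finset.prod_range_succ']
  simp only [one_div]
  norm_num
  ring

lemma cc_tendsto : Filter.Tendsto (fun n => Pm (n+1) / 2) Filter.atTop (nhds cc) := by
  have hs : Summable (fun j : ℕ => -((2:ℝ)⁻¹ ^ 2 ^ (j+1))) := by
    apply Summable.neg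
    refine Summable.of_nonneg_of_le (fun j => by positivity) (fun j => ?_)
      (summable_geometric_of_lt_one (by norm_num : (0:ℝ) ≤ 2⁻¹) (by norm_num))
    refine pow_le_pow_of_le_one (by norm_num) (by norm_num) ?_
    exact le_trans (Nat.le_succ j) (Nat.lt_two_pow_self).le
  have hm : Multipliable (fun j : ℕ => 1 - (2:ℝ)⁻¹ ^ 2 ^ (j+1)) := by
    simpa [sub_eq_add_neg] using Real.multipliable_one_add_of_summable hs
  have := hm.tendsto_prod_tprod_nat.const_mul (1/4)
  simp only [Pm_quarter] at this
  exact this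

lemma Pm_anti : Antitone Pm := by
  refine antitone_nat_of_succ_le fun n => ?_
  rw [Pm_succ]
  exact mul_le_of_le_one_right (Pm_pos n).le (by linarith [zm_pos n])

lemma cc_le (n : ℕ) : cc ≤ Pm (n+1) / 2 := by
  refine Antitone.le_of_tendsto (f := fun n => Pm (n+1) / 2) (fun i j hij => ?_) cc_tendsto n
  have := Pm_anti (Nat.succ_le_succ hij)
  simp only
  simp only [Nat.succ_eq_add_one] at this
  linarith

lemma cc_small : cc ≤ 45/256 := by
  have := cc_le 2
  norm_num [Pm, Finset.prod_range_succ] at this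
  linarith

lemma Pm_lower (n : ℕ) : (1/3) * (1 + 2 * (1/2)^2^(n+1)) ≤ Pm (n+1) := by
  induction n with
  | zero => norm_num [Pm]
  | succ n ih =>
    rw [Pm_succ]
    have e1 : ((1:ℝ)/2)^2^(n+1+1) = ((1/2)^2^(n+1))^2 := by rw [pow_succ 2 (n+1), pow_mul]
    have e2 : ((1:ℝ)/2)^2^(n+1) = ((1/2)^2^n)^2 := by rw [pow_succ 2 n, pow_mul]
    have h1 := zm_pos (n+1)
    have h2 : ((1:ℝ)/2)^2^(n+1) ≤ 1/4 := by
      rw [e2]; nlinarith [zm_pos n, zm_le n]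
    rw [e1]
    generalize ((1:ℝ)/2)^2^(n+1) = z at *
    nlinarith [mul_le_mul_of_nonneg_right ih (by linarith : 0 ≤ 1 - z)]

lemma cc_pos : 0 < cc := by
  have : (1/6 : ℝ) ≤ cc := ge_of_tendsto' cc_tendsto fun n => by
    linarith [Pm_lower n, zm_pos (n+1)]
  linarith

lemma al_be (m : ℕ) : al (m+1) + cc ≤ be m := by
  have h1 := zm_pos m
  have h2 := zm_le m
  have h3 := Pm_pos m
  have hc := cc_le (m+2)
  have e1 : ((1:ℝ)/2)^2^(m+1) = ((1/2)^2^m)^2 := by rw [pow_succ, pow_mul]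
  have e2 : ((1:ℝ)/2)^2^(m+2) = ((1/2)^2^m)^4 := by
    rw [show (2:ℕ)^(m+2) = 2^m*4 by ring, pow_mul]
  rw [Pm_succ, Pm_succ, Pm_succ, e1, e2] at hc
  unfold al be
  rw [Pm_succ, e1]
  generalize ((1:ℝ)/2)^2^m = z at *
  generalize Pm m = P at *
  have hz : z^2 ≤ 1/4 := by nlinarith
  have key : (1 - z) * (1 - z^2) * (1 - z^4) / 2 ≤
      (1 - 2*z^2) / (4*(1+z)) + (1-z) / (4*(1+z^2)) := by
    rw [div_add_div _ _ (by positivity) (by positivity), div_le_div_iff₀ (by norm_num)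
      (by positivity)]
    have hw : (1 - z^2) * (1 - z^4)^2 ≤ 1 - z^2 - z^4 := by
      have e : z^4 = (z^2)^2 := by ring
      rw [e]
      have h0 : 0 ≤ z^2 := sq_nonneg z
      generalize z^2 = w at *
      have : 0 ≤ w^2 * (1 - 2*w - w^2 + w^3) := by
        apply mul_nonneg (sq_nonneg w)
        have : 0 ≤ w^3 := by positivity
        nlinarith
      nlinarith
    nlinarith
  have h4 := mul_le_mul_of_nonneg_left key h3.le
  have e3 : P * ((1 - 2*z^2) / (4*(1+z)) + (1-z) / (4*(1+z^2))) =
      P * (1 - 2*z^2) / (4*(1+z)) + P * (1-z) / (4*(1+z^2)) := by ring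
  rw [e3] at h4
  have e4 : P * ((1 - z) * (1 - z^2) * (1 - z^4) / 2) =
    P * (1 - z) * (1 - z^2) * (1 - z^4) / 2 := by ring
  rw [e4] at h4
  linarith

lemma unc_mono {a b a' b' : ℝ} (h1 : a ≤ a') (h2 : b' ≤ b) (h : ¬ (J a b).Countable) :
    ¬ (J a' b').Countable := fun hc => h (hc.mono (J_mono h1 h2))

lemma U_left {a b : ℝ} (ha : 1/4 < a) (ha' : a < 1/2 - cc/2) (hb : b < a + cc) :
    ¬ (J a b).Countable := by
  have hc := cc_small
  rcases le_or_gt a (9/32) with h1 | h1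
  · exact unc_mono ha.le (by linarith) sp1_unc
  rcases le_or_gt a (1/3) with h2 | h2
  · exact unc_mono h1.le (by linarith) sp2_unc
  have h0 : al 0 = 1/3 := by norm_num [al, Pm]
  have hex : ∃ m, a < al m := by
    obtain ⟨n, hn⟩ := (cc_tendsto.eventually (gt_mem_nhds (by linarith : cc < 1 - 2*a))).exists
    refine ⟨n+1, ?_⟩
    unfold al
    have hz := zm_pos (n+1)
    have : Pm (n+1) / (4 * (1 + (1/2)^2^(n+1))) ≤ Pm (n+1) / 4 := by
      apply div_le_div_of_nonneg_left (Pm_pos _).le (by norm_num)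
      linarith
    linarith
  classical
  obtain ⟨m, hm⟩ : ∃ m, Nat.find hex = m + 1 := by
    apply Nat.exists_eq_succ_of_ne_zero
    intro h
    have := Nat.find_spec hex
    rw [h] at this; linarith
  have h3 := Nat.find_spec hex
  have h4 := Nat.find_min hex (m := m) (by omega)
  rw [hm] at h3
  rw [not_lt] at h4
  exact unc_mono h4 le_rfl (main_unc m (by linarith [al_be m]))

lemma dbl_one_sub {x : ℝ} (h : x ≠ 1/2) : Dbl (1 - x) = 1 - Dbl x := by
  rcases lt_or_gt_of_ne h with h | h
  · rw [dbl_le h.le, dbl_gt (by linarith)]; ring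
  · rw [dbl_gt h, dbl_le (by linarith)]; ring

lemma J_mirror {a b x : ℝ} (ha : a < 1/2) (hb : 1/2 < b) (hx : x ∈ J a b) :
    1 - x ∈ J (1-b) (1-a) := by
  have hit : ∀ n, Dbl^[n] (1-x) = 1 - Dbl^[n] x := by
    intro n
    induction n with
    | zero => rfl
    | succ n ih =>
      rw [Function.iterate_succ_apply', Function.iterate_succ_apply', ih, dbl_one_sub]
      intro h
      apply hx.2 n
      rw [h]; exact ⟨ha, hb⟩
  refine ⟨⟨by linarith [hx.1.2], by linarith [hx.1.1]⟩, fun n hn => hx.2 n ?_⟩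
  rw [hit n] at hn
  exact ⟨by linarith [hn.2], by linarith [hn.1]⟩

lemma unc_mirror {a b : ℝ} (ha : a < 1/2) (hb : 1/2 < b) (h : ¬ (J a b).Countable) :
    ¬ (J (1-b) (1-a)).Countable := by
  intro hc
  apply h
  refine (hc.image (fun x => 1 - x)).mono ?_
  intro x hx
  exact ⟨1 - x, J_mirror ha hb hx, by simp⟩

lemma U_star {b : ℝ} (hb : b < 1/2 + cc/2) : ¬ (J (1/2 - cc/2) b).Countable := by
  have hc := cc_small
  obtain ⟨a, h1, h2⟩ : ∃ a, max (b - cc) (1/3) < a ∧ a < 1/2 - cc/2 :=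
    exists_between (max_lt (by linarith) (by linarith))
  rw [max_lt_iff] at h1
  exact unc_mono h2.le le_rfl (U_left (by linarith) h2 (by linarith))

lemma U_le {a b : ℝ} (ha : 1/4 < a) (ha' : a ≤ 1/2 - cc/2) (hb : b < a + cc) :
    ¬ (J a b).Countable := by
  rcases ha'.lt_or_eq with h | h
  · exact U_left ha h hb
  · rw [h]; exact U_star (by linarith)

lemma U_all {a b : ℝ} (ha : 1/4 < a) (ha' : a < 1/2) (hb : b < a + cc) :
    ¬ (J a b).Countable := by
  have hc := cc_small
  rcases le_or_gt a (1/2 - cc/2) with h | h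
  · exact U_le ha h hb
  · set b1 := max b (1/2 + cc/2) with hb1
    have h1 : b1 < a + cc := max_lt hb (by linarith)
    have h2 : 1/2 + cc/2 ≤ b1 := le_max_right _ _
    have h3 := U_le (a := 1 - b1) (b := 1 - a) (by linarith) (by linarith) (by linarith)
    have h4 := unc_mirror (by linarith) (by linarith) h3
    rw [sub_sub_cancel, sub_sub_cancel] at h4
    exact unc_mono le_rfl (le_max_left _ _) h4

theorem stmt14 (a : ℝ) (ha : a ∈ Set.Ioo (1/4 : ℝ) (1/2)) :
    a + 1/4 ≤ phi a ∧ phi a ≤ a + 1/3 ∧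
    a + (1/4) * (∏' j : ℕ, (1 - (2:ℝ)⁻¹ ^ 2 ^ (j+1))) ≤ chi a ∧ chi a ≤ a + 1/4 := by
  obtain ⟨h1, h2⟩ := ha
  have hc := cc_small
  refine ⟨?_, ?_, ?_, ?_⟩
  · refine le_of_forall_lt fun c hcl => ?_
    obtain ⟨b, hb1, hb2⟩ : ∃ b, max c (1/2) < b ∧ b < a + 1/4 :=
      exists_between (max_lt hcl (by linarith))
    rw [max_lt_iff] at hb1
    refine lt_of_lt_of_le hb1.1 (le_csSup ⟨1, fun x hx => hx.1.2.le⟩ ?_)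
    exact ⟨⟨by linarith, by linarith⟩, phi_exists h1 h2 hb1.2 hb2⟩
  · exact Real.sSup_le (fun b hb => phi_ub h1 h2 hb.1.2 hb.2) (by linarith)
  · change a + cc ≤ chi a
    have hbd : BddAbove {b | b ∈ Set.Ioo a 1 ∧ ¬ (J a b).Countable} := ⟨1, fun x hx => hx.1.2.le⟩
    have hpos : 0 < cc := cc_pos
    refine le_of_forall_lt fun c hcl => ?_
    obtain ⟨b, hb1, hb2⟩ : ∃ b, max c a < b ∧ b < a + cc :=
      exists_between (max_lt hcl (by linarith))
    rw [max_lt_iff] at hb1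
    refine lt_of_lt_of_le hb1.1 (le_csSup hbd ?_)
    exact ⟨⟨hb1.2, by linarith⟩, U_all h1 h2 hb2⟩
  · exact Real.sSup_le (fun b hb => chi_ub h1 h2 hb.1.2 hb.2) (by linarith)

end
end

section
/- Every first order critical hole (a₀,b₀) for the doubling map is of one of the following forms: (1) (a, 1/2) or (1/2, 1−a) for some a ∈ (0,1/4]; (2) (a, a + 1/4) for some a ∈ 𝒮; (3) (π(s^∞), b) where s = ω_r^−, t = ω_r^+ for some r ∈ ℚ∩(0,1) and b ∈ [π(t s^∞), π(t^∞)]; (4) (a, π(t^∞)) where s = ω_r^−, t = ω_r^+ for some r ∈ ℚ∩(0,1) and a ∈ (π(s^∞), π(s t^∞)]. -/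
noncomputable section

/-- First order critical hole. -/
def FOCH (a0 b0 : ℝ) : Prop :=
  0 < a0 ∧ a0 < b0 ∧ b0 < 1 ∧
  (∀ a b : ℝ, 0 < a → a < b → b < 1 → a < a0 → b0 < b → J a b = ({0, 1} : Set ℝ)) ∧
  (∀ a b : ℝ, 0 < a → a < b → b < 1 → a0 < a → b < b0 → J a b ≠ ({0, 1} : Set ℝ))


/-! ### Floor and ceiling series -/

lemma summable_aux (A : ℕ → ℝ) (C : ℝ) (k : ℕ) (h : ∀ n, |A n| ≤ C * (n + 1)) :
    Summable (fun n => A n / 2 ^ (n + k)) := by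
  have h1 : Summable (fun n : ℕ => (n : ℝ) ^ 1 * (1/2 : ℝ) ^ n) :=
    summable_pow_mul_geometric_of_norm_lt_one 1 (by norm_num)
  have h2 : Summable (fun n : ℕ => (1/2 : ℝ) ^ n) := summable_geometric_two
  have h3 : Summable (fun n : ℕ => C * ((n : ℝ) ^ 1 * (1/2 : ℝ) ^ n + (1/2) ^ n)) :=
    (h1.add h2).mul_left C
  refine Summable.of_norm_bounded h3 (fun n => ?_)
  rw [Real.norm_eq_abs, abs_div, abs_of_pos (by positivity : (0:ℝ) < 2 ^ (n + k))]
  have e : C * ((n : ℝ) ^ 1 * (1/2 : ℝ) ^ n + (1/2) ^ n) = C * (n + 1) / 2 ^ n := by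
    rw [one_div, inv_pow]; field_simp
  rw [e]
  have h0 : 0 ≤ C * (n + 1) := (abs_nonneg _).trans (h n)
  apply div_le_div₀ h0 (h n) (by positivity)
  exact pow_le_pow_right₀ (by norm_num) (by omega)

lemma abs_ceil_le (x : ℝ) : |(⌈x⌉ : ℝ)| ≤ |x| + 1 := by
  have h1 := Int.le_ceil x
  have h2 := Int.ceil_lt_add_one x
  rw [abs_le]
  constructor
  · have := neg_abs_le x; linarith
  · have := le_abs_self x; linarith

lemma abs_floor_le (x : ℝ) : |(⌊x⌋ : ℝ)| ≤ |x| + 1 := by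
  have h1 := Int.floor_le x
  have h2 := Int.sub_one_lt_floor x
  rw [abs_le]
  constructor
  · have := neg_abs_le x; linarith
  · have := le_abs_self x; linarith

lemma abs_lin_le (θ α : ℝ) (n : ℕ) : |(n : ℝ) * θ + α| + 1 ≤ (|θ| + |α| + 1) * (n + 1) := by
  have h1 : |(n : ℝ) * θ + α| ≤ n * |θ| + |α| := by
    refine (abs_add_le _ _).trans ?_
    rw [abs_mul, Nat.abs_cast]
  have hn : (0 : ℝ) ≤ n := Nat.cast_nonneg n
  nlinarith [abs_nonneg θ, abs_nonneg α, mul_nonneg hn (abs_nonneg α)]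

lemma summable_ceil (θ α : ℝ) (k : ℕ) :
    Summable (fun n : ℕ => (⌈(n : ℝ) * θ + α⌉ : ℝ) / 2 ^ (n + k)) :=
  summable_aux _ (|θ| + |α| + 1) k fun n => (abs_ceil_le _).trans (abs_lin_le θ α n)

lemma summable_floor (θ α : ℝ) (k : ℕ) :
    Summable (fun n : ℕ => (⌊(n : ℝ) * θ + α⌋ : ℝ) / 2 ^ (n + k)) :=
  summable_aux _ (|θ| + |α| + 1) k fun n => (abs_floor_le _).trans (abs_lin_le θ α n)

def Fc (θ α : ℝ) : ℝ := ∑' n : ℕ, (⌈(n : ℝ) * θ + α⌉ : ℝ) / 2 ^ (n + 1)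
def Hf (θ α : ℝ) : ℝ := ∑' n : ℕ, (⌊(n : ℝ) * θ + α⌋ : ℝ) / 2 ^ (n + 1)

lemma tsum_half : ∑' n : ℕ, (1 : ℝ) / 2 ^ (n + 1) = 1 := by
  have := tsum_geometric_two' 1
  refine Eq.trans (tsum_congr (fun n => ?_)) this
  rw [pow_succ]; field_simp

lemma summable_half : Summable (fun n : ℕ => (1 : ℝ) / 2 ^ (n + 1)) :=
  summable_aux (fun _ => 1) 1 1 (fun n => by simp)

lemma Fc_step (θ α : ℝ) : 2 * Fc θ α = ⌈α⌉ + Fc θ (α + θ) := by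
  unfold Fc
  rw [(summable_ceil θ α 1).tsum_eq_zero_add, mul_add, ← tsum_mul_left]
  congr 1
  · simp; ring
  · congr 1; ext n
    push_cast
    rw [show ((n : ℝ) + 1) * θ + α = n * θ + (α + θ) by ring, pow_succ]
    field_simp

lemma Hf_step (θ α : ℝ) : 2 * Hf θ α = ⌊α⌋ + Hf θ (α + θ) := by
  unfold Hf
  rw [(summable_floor θ α 1).tsum_eq_zero_add, mul_add, ← tsum_mul_left]
  congr 1
  · simp; ring
  · congr 1; ext n
    push_cast
    rw [show ((n : ℝ) + 1) * θ + α = n * θ + (α + θ) by ring, pow_succ]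
    field_simp

lemma Fc_add_int (θ α : ℝ) (m : ℤ) : Fc θ (α + m) = Fc θ α + m := by
  unfold Fc
  have : (m : ℝ) = ∑' n : ℕ, (m : ℝ) * (1 / 2 ^ (n + 1)) := by
    rw [tsum_mul_left, tsum_half, mul_one]
  conv_rhs => rw [this]
  rw [← (summable_ceil θ α 1).tsum_add (summable_half.mul_left _)]
  congr 1; ext n
  rw [← add_assoc, Int.ceil_add_intCast]; push_cast; ring

lemma Hf_add_int (θ α : ℝ) (m : ℤ) : Hf θ (α + m) = Hf θ α + m := by
  unfold Hf
  have : (m : ℝ) = ∑' n : ℕ, (m : ℝ) * (1 / 2 ^ (n + 1)) := by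
    rw [tsum_mul_left, tsum_half, mul_one]
  conv_rhs => rw [this]
  rw [← (summable_floor θ α 1).tsum_add (summable_half.mul_left _)]
  congr 1; ext n
  rw [← add_assoc, Int.floor_add_intCast]; push_cast; ring

lemma Fc_mono (θ : ℝ) {α β : ℝ} (h : α ≤ β) : Fc θ α ≤ Fc θ β := by
  refine (summable_ceil θ α 1).tsum_le_tsum (fun n => ?_) (summable_ceil θ β 1)
  gcongr

/-- The left critical value attached to the rotation number `θ`. -/
def PP (θ : ℝ) : ℝ := Fc θ θ / 4
/-- The right critical value attached to the rotation number `θ`. -/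
def QQ (θ : ℝ) : ℝ := 1/2 + Hf θ θ / 4

lemma Fc_zero (θ : ℝ) : Fc θ 0 = 2 * PP θ := by
  have := Fc_step θ 0
  simp at this
  unfold PP; linarith

lemma Hf_zero (θ : ℝ) : Hf θ 0 = 2 * QQ θ - 1 := by
  have := Hf_step θ 0
  simp at this
  unfold QQ; linarith

lemma Fc_neg {θ : ℝ} (h0 : 0 < θ) (h1 : θ < 1) : Fc θ (-θ) = PP θ := by
  have := Fc_step θ (-θ)
  have e : ⌈-θ⌉ = 0 := by rw [Int.ceil_eq_iff]; constructor <;> push_cast <;> linarith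
  rw [e, neg_add_cancel, Fc_zero] at this
  push_cast at this; linarith

lemma Hf_neg {θ : ℝ} (h0 : 0 < θ) (h1 : θ < 1) : Hf θ (-θ) = QQ θ - 1 := by
  have := Hf_step θ (-θ)
  have e : ⌊-θ⌋ = -1 := by rw [Int.floor_eq_iff]; constructor <;> push_cast <;> linarith
  rw [e, neg_add_cancel, Hf_zero] at this
  push_cast at this; linarith

lemma PP_one : PP 1 = 1/2 := by
  have h1 := Fc_step 1 0
  have h2 := Fc_add_int 1 0 1
  have h3 := Fc_zero 1
  simp at h1 h2
  linarith

lemma QQ_zero : QQ 0 = 1/2 := by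
  unfold QQ Hf; simp

lemma QQ_mono {θ θ' : ℝ} (h : θ ≤ θ') : QQ θ ≤ QQ θ' := by
  unfold QQ
  have : Hf θ θ ≤ Hf θ' θ' := by
    refine (summable_floor θ θ 1).tsum_le_tsum (fun n => ?_) (summable_floor θ' θ' 1)
    gcongr
  linarith

lemma Hf_one_eq (θ : ℝ) : Hf θ (θ + 1) = 4 * (QQ θ - 1/4) := by
  have := Hf_add_int θ θ 1
  push_cast at this
  rw [this]; unfold QQ; ring

lemma PP_le_QQ (θ : ℝ) : PP θ ≤ QQ θ - 1/4 := by
  have : Fc θ θ ≤ Hf θ (θ + 1) := by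
    refine (summable_ceil θ θ 1).tsum_le_tsum (fun n => ?_) (summable_floor θ (θ+1) 1)
    rw [← add_assoc, Int.floor_add_one]
    gcongr
    exact Int.ceil_le_floor_add_one _
  rw [Hf_one_eq] at this
  unfold PP; linarith

lemma QQ_lt_PP {θ θ' : ℝ} (h : θ < θ') : QQ θ - 1/4 < PP θ' := by
  have : Hf θ (θ + 1) < Fc θ' θ' := by
    obtain ⟨N, hN⟩ := exists_nat_gt (2 / (θ' - θ))
    have hpos : 0 < θ' - θ := by linarith
    rw [div_lt_iff₀ hpos] at hN
    refine (summable_floor θ (θ+1) 1).tsum_lt_tsum (i := N) (fun n => ?_) ?_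
      (summable_ceil θ' θ' 1)
    · rw [← add_assoc, Int.floor_add_one]
      gcongr
      have : ⌊(n:ℝ) * θ + θ⌋ < ⌈(n:ℝ) * θ' + θ'⌉ := by
        rw [Int.lt_ceil]
        have := Int.floor_le ((n:ℝ) * θ + θ)
        have hn : (0:ℝ) ≤ n := Nat.cast_nonneg n
        nlinarith
      omega
    · rw [← add_assoc, Int.floor_add_one]
      gcongr
      rw [Int.lt_ceil]
      push_cast
      have := Int.floor_le ((N:ℝ) * θ + θ)
      nlinarith
  rw [Hf_one_eq] at this
  unfold PP; linarith

lemma PP_strictMono {θ θ' : ℝ} (h : θ < θ') : PP θ < PP θ' :=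
  (PP_le_QQ θ).trans_lt (QQ_lt_PP h)

lemma PP_irr {θ : ℝ} (h : Irrational θ) : PP θ = QQ θ - 1/4 := by
  have : Fc θ θ = Hf θ (θ + 1) := by
    unfold Fc Hf
    congr 1; ext n
    rw [← add_assoc, Int.floor_add_one]
    congr 2
    rw [Int.ceil_eq_iff]
    have h1 := Int.floor_le ((n:ℝ) * θ + θ)
    have h2 := Int.lt_floor_add_one ((n:ℝ) * θ + θ)
    push_cast
    refine ⟨?_, h2.le⟩
    rw [add_sub_cancel_right]
    refine lt_of_le_of_ne h1 (fun he => ?_)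
    have : Irrational (((n+1 : ℕ) : ℝ) * θ) := h.natCast_mul (by omega)
    apply this.ne_int ⌊(n:ℝ) * θ + θ⌋
    rw [he]; push_cast; ring
  rw [Hf_one_eq] at this
  unfold PP; linarith

lemma PP_gt {θ : ℝ} (h0 : 0 < θ) : 1/4 < PP θ := by
  have := QQ_lt_PP h0
  rw [QQ_zero] at this; linarith

lemma QQ_gt {θ : ℝ} (h0 : 0 < θ) : 1/2 < QQ θ := by
  have := PP_gt h0
  have := PP_le_QQ θ; linarith

lemma PP_lt {θ : ℝ} (h1 : θ < 1) : PP θ < 1/2 := by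
  have := PP_strictMono h1
  rw [PP_one] at this; linarith


open Filter Topology in
lemma Hf_tendsto (θ : ℝ) (l : Filter ℝ) [l.NeBot] (hl : l ≤ 𝓝 θ) (A : ℕ → ℤ)
    (h : ∀ n : ℕ, Tendsto (fun x : ℝ => ⌊(n:ℝ) * x + x⌋) l (pure (A n))) :
    Tendsto (fun x => Hf x x) l (𝓝 (∑' n : ℕ, (A n : ℝ) / 2 ^ (n + 1))) := by
  unfold Hf
  refine tendsto_tsum_of_dominated_convergence
    (bound := fun n : ℕ => ((2 * (|θ| + 1) + 1) * (n + 1)) / 2 ^ (n + 1)) ?_ ?_ ?_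
  · exact summable_aux (fun n : ℕ => (2 * (|θ| + 1) + 1) * (n + 1)) _ 1 (fun n => by
      rw [abs_of_nonneg (by positivity)])
  · intro n
    refine Tendsto.div_const ?_ _
    exact ((tendsto_pure_pure (fun z : ℤ => (z : ℝ)) _).comp (h n)).mono_right (pure_le_nhds _)
  · have h1 : ∀ᶠ x in l, |x| < |θ| + 1 := by
      apply hl
      exact (continuous_abs.continuousAt (x := θ)).eventually (Iio_mem_nhds (by linarith))
    filter_upwards [h1] with x hx n
    rw [Real.norm_eq_abs, abs_div, abs_of_pos (by positivity : (0:ℝ) < 2 ^ (n + 1))]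
    gcongr
    refine ((abs_floor_le _).trans (abs_lin_le x x n)).trans ?_
    gcongr
    linarith

open Filter Topology in
lemma QQ_right (θ : ℝ) {b : ℝ} (hb : QQ θ < b) : ∃ θ' > θ, QQ θ' < b := by
  have h1 : Tendsto (fun x => Hf x x) (𝓝[>] θ) (𝓝 (Hf θ θ)) := by
    refine Hf_tendsto θ _ nhdsWithin_le_nhds (fun n => ⌊(n:ℝ) * θ + θ⌋) (fun n => ?_)
    refine (tendsto_floor_right_pure_floor ((n:ℝ) * θ + θ)).comp ?_
    apply tendsto_nhdsWithin_of_tendsto_nhds_of_eventually_within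
    · have : Continuous (fun θ' : ℝ => (n:ℝ) * θ' + θ') := by fun_prop
      exact this.continuousAt.tendsto.mono_left nhdsWithin_le_nhds
    · filter_upwards [self_mem_nhdsWithin] with x hx
      have hx' : θ < x := hx
      simp only [Set.mem_Ici]
      gcongr
  have h2 : Tendsto QQ (𝓝[>] θ) (𝓝 (QQ θ)) := (h1.div_const 4).const_add (1/2)
  have h3 := h2.eventually (Iio_mem_nhds hb)
  obtain ⟨x, hx, hx2⟩ := (h3.and self_mem_nhdsWithin).exists
  exact ⟨x, hx2, hx⟩

open Filter Topology in
lemma QQ_left (θ : ℝ) (hθ : 0 < θ) {b : ℝ} (hb : b < PP θ + 1/4) :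
    ∃ θ', 0 < θ' ∧ θ' < θ ∧ b < QQ θ' := by
  have h1 : Tendsto (fun x => Hf x x) (𝓝[<] θ)
      (𝓝 (∑' n : ℕ, ((⌈(n:ℝ) * θ + θ⌉ - 1 : ℤ) : ℝ) / 2 ^ (n + 1))) := by
    refine Hf_tendsto θ _ nhdsWithin_le_nhds (fun n => ⌈(n:ℝ) * θ + θ⌉ - 1) (fun n => ?_)
    refine (tendsto_floor_left_pure_ceil_sub_one ((n:ℝ) * θ + θ)).comp ?_
    apply tendsto_nhdsWithin_of_tendsto_nhds_of_eventually_within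
    · have : Continuous (fun θ' : ℝ => (n:ℝ) * θ' + θ') := by fun_prop
      exact this.continuousAt.tendsto.mono_left nhdsWithin_le_nhds
    · filter_upwards [self_mem_nhdsWithin] with x hx
      have hx' : x < θ := hx
      simp only [Set.mem_Iio]
      have hn : (0:ℝ) ≤ n := Nat.cast_nonneg n
      nlinarith
  have e : ∑' n : ℕ, ((⌈(n:ℝ) * θ + θ⌉ - 1 : ℤ) : ℝ) / 2 ^ (n + 1) = 4 * PP θ - 1 := by
    have h := Fc_add_int θ θ (-1)
    have h' : Fc θ (θ + (-1 : ℤ)) = ∑' n : ℕ, ((⌈(n:ℝ) * θ + θ⌉ - 1 : ℤ) : ℝ) / 2 ^ (n + 1) := by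
      unfold Fc
      refine tsum_congr (fun n => ?_)
      rw [← add_assoc, Int.ceil_add_intCast]; rfl
    rw [← h', h]; unfold PP; push_cast; ring
  rw [e] at h1
  have h2 : Tendsto QQ (𝓝[<] θ) (𝓝 (1/2 + (4 * PP θ - 1) / 4)) := (h1.div_const 4).const_add (1/2)
  have h3 := h2.eventually (Ioi_mem_nhds (by linarith : b < 1/2 + (4 * PP θ - 1) / 4))
  have h4 : ∀ᶠ x in 𝓝[<] θ, 0 < x := mem_nhdsWithin_of_mem_nhds (Ioi_mem_nhds hθ)
  obtain ⟨x, ⟨hx, hx2⟩, hx3⟩ := ((h3.and self_mem_nhdsWithin).and h4).exists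
  exact ⟨x, hx3, hx2, hx⟩

/-! ### Survivors -/

lemma J_nontrivial {θ : ℝ} (h0 : 0 < θ) (h1 : θ < 1) {a b : ℝ} (ha : PP θ ≤ a) (hb : b ≤ QQ θ) :
    J a b ≠ ({0, 1} : Set ℝ) := by
  set X : ℕ → ℝ := fun k => Fc θ (k * θ - θ) - ⌈(k:ℝ) * θ - θ⌉ with hX
  have hX0 : X 0 = PP θ := by
    simp only [hX]
    have e : ⌈-θ⌉ = 0 := by rw [Int.ceil_eq_iff]; constructor <;> push_cast <;> linarith
    simp [Fc_neg h0 h1, e]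
  have key : ∀ k, (X k ≤ PP θ ∧ X (k+1) = 2 * X k) ∨ (QQ θ ≤ X k ∧ X (k+1) = 2 * X k - 1) := by
    intro k
    simp only [hX]
    set α := (k:ℝ) * θ - θ with hα
    have e : ((k+1 : ℕ) : ℝ) * θ - θ = α + θ := by push_cast; rw [hα]; ring
    rw [e]
    have hs := Fc_step θ α
    have c1 := Int.le_ceil α
    have c2 := Int.ceil_lt_add_one α
    rcases le_or_gt (α + θ) ⌈α⌉ with hle | hgt
    · left
      have e2 : ⌈α + θ⌉ = ⌈α⌉ := by rw [Int.ceil_eq_iff]; constructor <;> linarith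
      rw [e2]
      refine ⟨?_, by linarith⟩
      have := Fc_mono θ (show α ≤ -θ + (⌈α⌉ : ℤ) by linarith)
      rw [Fc_add_int, Fc_neg h0 h1] at this
      linarith
    · right
      have e2 : ⌈α + θ⌉ = ⌈α⌉ + 1 := by
        rw [Int.ceil_eq_iff]; push_cast; constructor <;> linarith
      rw [e2]
      push_cast
      refine ⟨?_, by linarith⟩
      have : Hf θ (-θ + ((⌈α⌉ + 1 : ℤ) : ℝ)) ≤ Fc θ α := by
        refine (summable_floor θ _ 1).tsum_le_tsum (fun n => ?_) (summable_ceil θ α 1)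
        gcongr
        rw [← add_assoc, Int.floor_add_intCast]
        have : ⌊(n:ℝ) * θ + -θ⌋ + ⌈α⌉ < ⌈(n:ℝ) * θ + α⌉ := by
          rw [Int.lt_ceil]; push_cast
          have := Int.floor_le ((n:ℝ) * θ + -θ)
          linarith
        omega
      rw [Hf_add_int, Hf_neg h0 h1] at this
      push_cast at this
      linarith
  have hP := PP_lt h1
  have hP' := PP_gt h0
  have hQ := QQ_gt h0
  have hit : ∀ k, Dbl^[k] (PP θ) = X k := by
    intro k
    induction k with
    | zero => simp [hX0]
    | succ k ih =>
      rw [Function.iterate_succ_apply', ih]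
      unfold Dbl
      rcases key k with ⟨h, h'⟩ | ⟨h, h'⟩
      · rw [if_pos (by linarith), h']
      · rw [if_neg (by linarith), h']
  intro hJ
  have hmem : PP θ ∈ J a b := by
    refine ⟨⟨by linarith, by linarith⟩, fun n hn => ?_⟩
    rw [hit] at hn
    rcases key n with ⟨h, -⟩ | ⟨h, -⟩
    · linarith [hn.1]
    · linarith [hn.2]
  rw [hJ] at hmem
  rcases hmem with h | h
  · linarith
  · have : PP θ = 1 := h
    linarith

lemma dbl_cases {a b x : ℝ} (ha : a < 1/2) (hb : 1/2 < b) (hx : x ∉ Set.Ioo a b) :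
    (x ≤ a ∧ Dbl x = 2 * x) ∨ (b ≤ x ∧ Dbl x = 2 * x - 1) := by
  unfold Dbl
  rcases le_or_gt x a with h | h
  · left; exact ⟨h, if_pos (by linarith)⟩
  · right
    have : b ≤ x := by
      by_contra h'
      exact hx ⟨h, by linarith⟩
    exact ⟨this, if_neg (by linarith)⟩

lemma zero_one_mem_J {a b : ℝ} (ha : 0 < a) (hb : b < 1) : ({0, 1} : Set ℝ) ⊆ J a b := by
  have d0 : Dbl 0 = 0 := by unfold Dbl; norm_num
  have d1 : Dbl 1 = 1 := by unfold Dbl; norm_num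
  rintro x (rfl | rfl)
  · refine ⟨⟨le_rfl, by norm_num⟩, fun n hn => ?_⟩
    rw [Function.iterate_fixed d0] at hn
    linarith [hn.1]
  · refine ⟨⟨by norm_num, le_rfl⟩, fun n hn => ?_⟩
    rw [Function.iterate_fixed d1] at hn
    linarith [hn.2]

lemma half_mem_J {a b : ℝ} (hb : b < 1) (h : (1/2 : ℝ) ∉ Set.Ioo a b) : (1/2 : ℝ) ∈ J a b := by
  have d1 : Dbl 1 = 1 := by unfold Dbl; norm_num
  have d2 : Dbl (1/2) = 1 := by unfold Dbl; norm_num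
  refine ⟨⟨by norm_num, by norm_num⟩, fun n hn => ?_⟩
  cases n with
  | zero => exact h (by simpa using hn)
  | succ n =>
    rw [Function.iterate_succ_apply, d2, Function.iterate_fixed d1] at hn
    linarith [hn.2]

lemma half_J_ne {a b : ℝ} (hb : b < 1) (h : (1/2 : ℝ) ∉ Set.Ioo a b) :
    J a b ≠ ({0, 1} : Set ℝ) := by
  intro hJ
  have := half_mem_J hb h
  rw [hJ] at this
  rcases this with h | h
  · norm_num at h
  · have : (1/2:ℝ) = 1 := h
    norm_num at this

/-- A sequence that doubles at each step and is bounded must be nonpositive. -/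
lemma no_doubling {u : ℕ → ℝ} (h0 : 0 < u 0) (hd : ∀ n, u (n+1) = 2 * u n) (C : ℝ)
    (hC : ∀ n, u n ≤ C) : False := by
  have h : ∀ n, u n = 2 ^ n * u 0 := by
    intro n
    induction n with
    | zero => simp
    | succ n ih => rw [hd, ih]; ring
  obtain ⟨n, hn⟩ := pow_unbounded_of_one_lt (C / u 0) (by norm_num : (1:ℝ) < 2)
  rw [div_lt_iff₀ h0] at hn
  have := hC n
  rw [h] at this
  linarith

lemma survivor_orbit {a b : ℝ} (ha0 : 0 < a) (ha : a < 1/2) (hb : 1/2 < b) (hb1 : b < 1)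
    (hJ : J a b ≠ ({0, 1} : Set ℝ)) :
    ∃ y : ℕ → ℝ, (∀ n, 2 * b - 1 ≤ y n ∧ y n ≤ 2 * a) ∧
      ∀ n, (y n ≤ a ∧ y (n+1) = 2 * y n) ∨ (b ≤ y n ∧ y (n+1) = 2 * y n - 1) := by
  have : ∃ x ∈ J a b, x ∉ ({0, 1} : Set ℝ) := by
    by_contra hcon
    push Not at hcon
    exact hJ (Set.Subset.antisymm hcon (zero_one_mem_J ha0 hb1))
  obtain ⟨x, hx, hx'⟩ := this
  set z : ℕ → ℝ := fun n => Dbl^[n] x with hz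
  have hstep : ∀ n, (z n ≤ a ∧ z (n+1) = 2 * z n) ∨ (b ≤ z n ∧ z (n+1) = 2 * z n - 1) := by
    intro n
    have := dbl_cases ha hb (hx.2 n)
    simp only [hz, Function.iterate_succ_apply']
    exact this
  have h01 : ∀ n, 0 < z n ∧ z n < 1 := by
    intro n
    induction n with
    | zero =>
      simp only [hz, Function.iterate_zero, id]
      simp only [Set.mem_insert_iff, Set.mem_singleton_iff, not_or] at hx'
      exact ⟨lt_of_le_of_ne hx.1.1 (Ne.symm hx'.1), lt_of_le_of_ne hx.1.2 hx'.2⟩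
    | succ n ih =>
      rcases hstep n with ⟨h, h'⟩ | ⟨h, h'⟩ <;> rw [h'] <;> constructor <;> linarith [ih.1, ih.2]
  have hent : ∃ N, 2 * b - 1 ≤ z N ∧ z N ≤ 2 * a := by
    by_contra hcon
    push Not at hcon
    by_cases hlo : ∀ n, z n < 2 * b - 1
    · refine no_doubling (h01 0).1 (fun n => ?_) 1 (fun n => (h01 n).2.le)
      rcases hstep n with ⟨h, h'⟩ | ⟨h, h'⟩
      · exact h'
      · linarith [hlo n]
    · push Not at hlo
      obtain ⟨M, hM⟩ := hlo
      have hall : ∀ k, 2 * b - 1 ≤ z (M + k) := by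
        intro k
        induction k with
        | zero => exact hM
        | succ k ih =>
          rw [← add_assoc]
          have := hcon _ ih
          rcases hstep (M+k) with ⟨h, h'⟩ | ⟨h, h'⟩ <;> rw [h'] <;> linarith
      refine no_doubling (u := fun k => 1 - z (M + k)) (by linarith [(h01 (M+0)).2])
        (fun k => ?_) 1 (fun k => by linarith [(h01 (M+k)).1])
      have := hcon _ (hall k)
      rcases hstep (M+k) with ⟨h, h'⟩ | ⟨h, h'⟩
      · linarith
      · show 1 - z (M + (k + 1)) = 2 * (1 - z (M + k))
        rw [← add_assoc, h']; ring
  obtain ⟨N, hN⟩ := hent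
  refine ⟨fun n => z (N + n), fun n => ?_, fun n => hstep (N + n)⟩
  induction n with
  | zero => exact hN
  | succ n ih =>
    simp only [← add_assoc]
    have := h01 (N + n)
    rcases hstep (N+n) with ⟨h, h'⟩ | ⟨h, h'⟩ <;> rw [h'] <;> constructor <;> linarith [ih.1, ih.2]

lemma J_trivial_left {a b : ℝ} (ha0 : 0 < a) (ha : a < b / 2) (hb : 1/2 < b) (hb1 : b < 1) :
    J a b = ({0, 1} : Set ℝ) := by
  by_contra hJ
  obtain ⟨y, hy, hs⟩ := survivor_orbit ha0 (by linarith) hb hb1 hJ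
  refine no_doubling (u := y) (by linarith [(hy 0).1]) (fun n => ?_) _ (fun n => (hy n).2)
  rcases hs n with ⟨h, h'⟩ | ⟨h, h'⟩
  · exact h'
  · linarith [(hy n).2]

/-! ### The rotation number -/

/-- The lift of the truncated doubling map. -/
def GG (c : ℝ) : CircleDeg1Lift where
  toFun x := min (2 * (x - ⌊x - c⌋)) (2 * c + 1) + ⌊x - c⌋
  monotone' := by
    intro x y hxy
    simp only
    have hk : ⌊x - c⌋ ≤ ⌊y - c⌋ := Int.floor_le_floor (by linarith)
    rcases hk.eq_or_lt with h | h
    · rw [h]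
      gcongr
    · have h1 : (⌊x - c⌋ : ℝ) + 1 ≤ ⌊y - c⌋ := by exact_mod_cast h
      have h2 := Int.floor_le (y - c)
      have h3 : min (2 * (x - ⌊x - c⌋)) (2 * c + 1) ≤ 2 * c + 1 := min_le_right _ _
      have h4 : 2 * c ≤ min (2 * (y - ⌊y - c⌋)) (2 * c + 1) :=
        le_min (by linarith) (by linarith)
      linarith
  map_add_one' := by
    intro x
    rw [show x + 1 - c = x - c + 1 by ring, Int.floor_add_one]
    push_cast
    rw [show x + 1 - ((⌊x - c⌋ : ℝ) + 1) = x - ⌊x - c⌋ by ring]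
    ring

lemma GG_apply (c x : ℝ) : GG c x = min (2 * (x - ⌊x - c⌋)) (2 * c + 1) + ⌊x - c⌋ := rfl

lemma GG_le (c x : ℝ) (k : ℤ) (hk : k = ⌊x - c⌋) : GG c x ≤ 2 * x - k := by
  rw [GG_apply, ← hk]
  have := min_le_left (2 * (x - (k:ℝ))) (2 * c + 1)
  linarith

lemma GG_of_mem {c x : ℝ} (h1 : c ≤ x) (h2 : x ≤ c + 1/2) : GG c x = 2 * x := by
  have : ⌊x - c⌋ = 0 := by rw [Int.floor_eq_iff]; constructor <;> push_cast <;> linarith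
  rw [GG_apply, this]
  push_cast
  rw [sub_zero, min_eq_left (by linarith)]; ring

lemma GG_of_mem' {c x : ℝ} (h1 : c - 1/2 ≤ x) (h2 : x ≤ c) : GG c x = 2 * c := by
  rcases h2.eq_or_lt with rfl | h2
  · exact GG_of_mem le_rfl (by linarith)
  have : ⌊x - c⌋ = -1 := by rw [Int.floor_eq_iff]; constructor <;> push_cast <;> linarith
  rw [GG_apply, this]
  push_cast
  rw [min_eq_right (by linarith)]; ring

lemma GG_ge {c x : ℝ} (k : ℤ) (h1 : c - 1/2 ≤ x - k) (h2 : x - k ≤ c + 1/2) :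
    2 * x - k ≤ GG c x := by
  have e : GG c x = GG c (x - k) + k := by
    rw [CircleDeg1Lift.map_sub_int]; ring
  rw [e]
  rcases le_total c (x - k) with h | h
  · rw [GG_of_mem h h2]; linarith
  · rw [GG_of_mem' h1 h]; linarith

/-- The rotation number. -/
def tau (c : ℝ) : ℝ := (GG c).translationNumber

lemma GG_iter_top (c : ℝ) (n : ℕ) : (GG c ^ (n+1)) (c + 1/2) = (GG c ^ (n+1)) (c + 1) := by
  rw [pow_succ, CircleDeg1Lift.mul_apply, CircleDeg1Lift.mul_apply]
  congr 1
  rw [CircleDeg1Lift.map_add_one, GG_of_mem le_rfl (by linarith),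
    GG_of_mem (by linarith) le_rfl]
  ring

lemma GG_iter_bot (c : ℝ) (n : ℕ) : (GG c ^ (n+1)) c = (GG c ^ (n+1)) (c - 1/2) := by
  rw [pow_succ, CircleDeg1Lift.mul_apply, CircleDeg1Lift.mul_apply]
  congr 1
  rw [GG_of_mem le_rfl (by linarith), GG_of_mem' le_rfl (by linarith)]

lemma GG_iter_succ (c : ℝ) (n : ℕ) (x : ℝ) : (GG c ^ (n+1)) x = GG c ((GG c ^ n) x) := by
  rw [pow_succ', CircleDeg1Lift.mul_apply]

open Filter Topology in
lemma two_PP_le (c : ℝ) : 2 * PP (tau c) ≤ c + 1/2 := by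
  set g : ℕ → ℝ := fun n => (GG c ^ n) (c + 1/2) with hg
  set E : ℕ → ℤ := fun n => ⌊g n - c⌋ with hE
  have hEt : ∀ n : ℕ, ⌈(n:ℝ) * tau c + 0⌉ ≤ E n := by
    intro n
    rw [Int.ceil_le, add_zero]
    rcases n with _ | n
    · simp only [hE, hg, pow_zero, CircleDeg1Lift.coe_one, id]
      have : ⌊c + 1/2 - c⌋ = 0 := by
        rw [Int.floor_eq_iff]; constructor <;> push_cast <;> linarith
      rw [this]; simp
    · unfold tau
      rw [← CircleDeg1Lift.translationNumber_pow]
      apply CircleDeg1Lift.translationNumber_le_of_le_add_int (x := c + 1)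
      rw [← GG_iter_top]
      have := Int.lt_floor_add_one (g (n+1) - c)
      simp only [hg, hE] at this ⊢
      linarith
  have hstep : ∀ n, g (n+1) ≤ 2 * g n - E n := by
    intro n
    simp only [hg]
    rw [GG_iter_succ]
    exact GG_le c _ _ rfl
  have hpart : ∀ N : ℕ, ∑ n ∈ Finset.range N, (⌈(n:ℝ) * tau c + 0⌉ : ℝ) / 2 ^ (n+1) + g N / 2 ^ N
      ≤ c + 1/2 := by
    intro N
    induction N with
    | zero => simp [hg]
    | succ N ih =>
      rw [Finset.sum_range_succ]
      have h1 := hstep N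
      have h2 : (⌈(N:ℝ) * tau c + 0⌉ : ℝ) ≤ E N := by exact_mod_cast hEt N
      have : (⌈(N:ℝ) * tau c + 0⌉ : ℝ) / 2 ^ (N+1) + g (N+1) / 2 ^ (N+1) ≤ g N / 2 ^ N := by
        rw [← add_div, pow_succ, div_le_div_iff₀ (by positivity) (by positivity)]
        have : (0:ℝ) < 2 ^ N := by positivity
        nlinarith
      linarith
  have hsum : Tendsto (fun N : ℕ => ∑ n ∈ Finset.range N, (⌈(n:ℝ) * tau c + 0⌉ : ℝ) / 2 ^ (n+1))
      atTop (𝓝 (Fc (tau c) 0)) := (summable_ceil (tau c) 0 1).hasSum.tendsto_sum_nat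
  have hlow : Tendsto (fun N : ℕ => (c + N * tau c) / 2 ^ N) atTop (𝓝 0) := by
    have := (summable_aux (fun n : ℕ => c + n * tau c) (|tau c| + |c| + 1) 0 (fun n => by
      have := abs_lin_le (tau c) c n
      rw [add_comm c]; linarith)).tendsto_atTop_zero
    simpa using this
  rw [← Fc_zero]
  have hl := hsum.add hlow
  rw [add_zero] at hl
  refine le_of_tendsto' hl (fun N => ?_)
  refine le_trans ?_ (hpart N)
  gcongr
  have h1 := Int.floor_le (g N - c)
  have h2 : (N:ℝ) * tau c ≤ E N := by
    have := Int.ceil_le.1 (hEt N)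
    linarith
  simp only [hE] at h2
  linarith

open Filter Topology in
lemma le_two_QQ (c : ℝ) : c ≤ 2 * QQ (tau c) - 1 := by
  set g : ℕ → ℝ := fun n => (GG c ^ n) c with hg
  set E : ℕ → ℤ := fun n => ⌈g n - (c + 1/2)⌉ with hE
  have hEt : ∀ n : ℕ, E n ≤ ⌊(n:ℝ) * tau c + 0⌋ := by
    intro n
    rw [Int.le_floor, add_zero]
    rcases n with _ | n
    · simp only [hE, hg, pow_zero, CircleDeg1Lift.coe_one, id]
      have : ⌈c - (c + 1/2)⌉ = 0 := by
        rw [Int.ceil_eq_iff]; constructor <;> push_cast <;> linarith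
      rw [this]; simp
    · unfold tau
      rw [← CircleDeg1Lift.translationNumber_pow]
      apply CircleDeg1Lift.le_translationNumber_of_add_int_le (x := c - 1/2)
      rw [← GG_iter_bot]
      have := Int.ceil_lt_add_one (g (n+1) - (c + 1/2))
      simp only [hg, hE] at this ⊢
      linarith
  have hstep : ∀ n, 2 * g n - E n ≤ g (n+1) := by
    intro n
    have h1 := Int.ceil_lt_add_one (g n - (c + 1/2))
    have h2 := Int.le_ceil (g n - (c + 1/2))
    have := GG_ge (c := c) (x := g n) (E n) (by simp only [hE]; linarith) (by simp only [hE]; linarith)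
    simp only [hg] at this ⊢
    rw [GG_iter_succ]
    exact this
  have hpart : ∀ N : ℕ, c ≤
      ∑ n ∈ Finset.range N, (⌊(n:ℝ) * tau c + 0⌋ : ℝ) / 2 ^ (n+1) + g N / 2 ^ N := by
    intro N
    induction N with
    | zero => simp [hg]
    | succ N ih =>
      rw [Finset.sum_range_succ]
      have h1 := hstep N
      have h2 : (E N : ℝ) ≤ ⌊(N:ℝ) * tau c + 0⌋ := by exact_mod_cast hEt N
      have : g N / 2 ^ N ≤ (⌊(N:ℝ) * tau c + 0⌋ : ℝ) / 2 ^ (N+1) + g (N+1) / 2 ^ (N+1) := by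
        rw [← add_div, pow_succ, div_le_div_iff₀ (by positivity) (by positivity)]
        have : (0:ℝ) < 2 ^ N := by positivity
        nlinarith
      linarith
  have hsum : Tendsto (fun N : ℕ => ∑ n ∈ Finset.range N, (⌊(n:ℝ) * tau c + 0⌋ : ℝ) / 2 ^ (n+1))
      atTop (𝓝 (Hf (tau c) 0)) := (summable_floor (tau c) 0 1).hasSum.tendsto_sum_nat
  have hlow : Tendsto (fun N : ℕ => ((c + 1/2) + N * tau c) / 2 ^ N) atTop (𝓝 0) := by
    have := (summable_aux (fun n : ℕ => (c + 1/2) + n * tau c) (|tau c| + |c + 1/2| + 1) 0 (fun n => by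
      have := abs_lin_le (tau c) (c + 1/2) n
      rw [add_comm (c + 1/2)]; linarith)).tendsto_atTop_zero
    simpa using this
  rw [← Hf_zero]
  have hl := hsum.add hlow
  rw [add_zero] at hl
  refine ge_of_tendsto' hl (fun N => ?_)
  refine le_trans (hpart N) ?_
  gcongr
  have h1 := Int.le_ceil (g N - (c + 1/2))
  have h2 : (E N : ℝ) ≤ (N:ℝ) * tau c := by
    have := Int.le_floor.1 (hEt N)
    linarith
  simp only [hE] at h2
  linarith

lemma tau_eq {c c' : ℝ} (hc : c ≤ c') (y : ℕ → ℝ) (hy : ∀ n, c' ≤ y n ∧ y n ≤ c + 1/2)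
    (hs : ∀ n, ∃ d : ℤ, y (n+1) = 2 * y n - d) : tau c = tau c' := by
  have key : ∀ n, ∃ k : ℤ, (GG c ^ n) (y 0) = y n + k ∧ (GG c' ^ n) (y 0) = y n + k := by
    intro n
    induction n with
    | zero => exact ⟨0, by simp, by simp⟩
    | succ n ih =>
      obtain ⟨k, h1, h2⟩ := ih
      obtain ⟨d, hd⟩ := hs n
      refine ⟨k + d, ?_, ?_⟩
      · rw [GG_iter_succ, h1, CircleDeg1Lift.map_add_int,
          GG_of_mem (by linarith [(hy n).1]) (hy n).2, hd]
        push_cast; ring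
      · rw [GG_iter_succ, h2, CircleDeg1Lift.map_add_int,
          GG_of_mem (hy n).1 (by linarith [(hy n).2]), hd]
        push_cast; ring
  have t1 := (GG c).tendsto_translationNumber (y 0)
  have t2 := (GG c').tendsto_translationNumber (y 0)
  refine tendsto_nhds_unique t1 (t2.congr (fun n => ?_))
  obtain ⟨k, h1, h2⟩ := key n
  rw [h1, h2]

lemma J_bound {a b : ℝ} (ha0 : 0 < a) (ha : a < 1/2) (hb : 1/2 < b) (hb1 : b < 1)
    (hab : a + 1/4 ≤ b) (hJ : J a b ≠ ({0, 1} : Set ℝ)) :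
    PP (tau (2 * a - 1/2)) ≤ a ∧ b ≤ QQ (tau (2 * a - 1/2)) := by
  obtain ⟨y, hy, hs⟩ := survivor_orbit ha0 ha hb hb1 hJ
  have e : tau (2 * a - 1/2) = tau (2 * b - 1) := by
    refine tau_eq (by linarith) y (fun n => ⟨(hy n).1, by linarith [(hy n).2]⟩) (fun n => ?_)
    rcases hs n with ⟨-, h⟩ | ⟨-, h⟩
    · exact ⟨0, by rw [h]; simp⟩
    · exact ⟨1, by rw [h]; simp⟩
  have h1 := two_PP_le (2 * a - 1/2)
  have h2 := le_two_QQ (2 * b - 1)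
  rw [← e] at h2
  constructor <;> linarith

/-- The combinatorics-free classification. -/
lemma classify {a0 b0 : ℝ} (h : FOCH a0 b0) :
    (0 < a0 ∧ a0 ≤ 1/4 ∧ b0 = 1/2) ∨ (a0 = 1/2 ∧ 3/4 ≤ b0 ∧ b0 < 1) ∨
    ∃ θ, 0 < θ ∧ θ < 1 ∧ 1/4 < a0 ∧ a0 < 1/2 ∧
      ((a0 = PP θ ∧ PP θ + 1/4 ≤ b0 ∧ b0 ≤ QQ θ) ∨
       (PP θ < a0 ∧ a0 ≤ QQ θ - 1/4 ∧ b0 = QQ θ)) := by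
  obtain ⟨ha, hab, hb, h1, h2⟩ := h
  have ha2 : a0 ≤ 1/2 := by
    by_contra hc
    push Not at hc
    exact half_J_ne (a := 1/2) (b := (b0 + 1)/2) (by linarith) (fun hm => lt_irrefl _ hm.1)
      (h1 _ _ (by linarith) (by linarith) (by linarith) (by linarith) (by linarith))
  have hb2 : 1/2 ≤ b0 := by
    by_contra hc
    push Not at hc
    exact half_J_ne (a := a0/2) (b := 1/2) (by linarith) (fun hm => lt_irrefl _ hm.2)
      (h1 _ _ (by linarith) (by linarith) (by linarith) (by linarith) (by linarith))
  have hlow : ∀ θ, 0 < θ → θ < 1 → PP θ < a0 → QQ θ ≤ b0 := by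
    intro θ t0 t1 hP
    by_contra hc
    push Not at hc
    have hm1 : b0 < min (QQ θ) 1 := lt_min hc hb
    obtain ⟨b, hb3, hb4⟩ := exists_between hm1
    have g1 := hb4.trans_le (min_le_left _ _)
    have g2 := hb4.trans_le (min_le_right _ _)
    have := PP_gt t0
    exact J_nontrivial t0 t1 le_rfl g1.le
      (h1 _ _ (by linarith) (by linarith) (by linarith) hP hb3)
  rcases le_or_gt a0 (1/4) with hq | hq
  · left
    refine ⟨ha, hq, ?_⟩
    by_contra hne
    have hgt : 1/2 < b0 := lt_of_le_of_ne hb2 (Ne.symm hne)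
    obtain ⟨b, hb3, hb4⟩ := exists_between hgt
    obtain ⟨a, ha3, ha4⟩ := exists_between (show a0 < b / 2 by linarith)
    exact h2 a b (by linarith) (by linarith) (by linarith) ha3 hb4
      (J_trivial_left (by linarith) ha4 hb3 (by linarith))
  right
  rcases ha2.eq_or_lt with he | hlt
  · left
    refine ⟨he, ?_, hb⟩
    by_contra hc
    push Not at hc
    obtain ⟨θ, t0, t1, ht⟩ := QQ_left 1 (by norm_num) (b := b0) (by rw [PP_one]; linarith)
    have := hlow θ t0 t1 (by rw [he]; exact PP_lt t1)
    linarith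
  right
  have hP := two_PP_le (2 * a0 - 1/2)
  have hQ := le_two_QQ (2 * a0 - 1/2)
  set θ := tau (2 * a0 - 1/2) with hθ
  have t1 : θ < 1 := by
    by_contra hc
    push Not at hc
    rcases hc.eq_or_lt with h | h
    · rw [← h, PP_one] at hP; linarith
    · have := PP_strictMono h
      rw [PP_one] at this; linarith
  have t0 : 0 < θ := by
    by_contra hc
    push Not at hc
    have := QQ_mono hc
    rw [QQ_zero] at this; linarith
  have hbQ : b0 ≤ QQ θ := by
    by_contra hc
    push Not at hc
    obtain ⟨b, hb3, hb4⟩ := exists_between hc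
    obtain ⟨θ', ht', hQ'⟩ := QQ_right θ hb3
    have hPθ' := QQ_lt_PP ht'
    have hm : a0 < min (PP θ') (min (b - 1/4) (1/2)) :=
      lt_min (by linarith) (lt_min (by linarith) hlt)
    obtain ⟨a, ha3, ha4⟩ := exists_between hm
    have g1 := ha4.trans_le (min_le_left _ _)
    have g2 := ha4.trans_le ((min_le_right _ _).trans (min_le_left _ _))
    have g3 := ha4.trans_le ((min_le_right _ _).trans (min_le_right _ _))
    have hQg := QQ_gt t0
    obtain ⟨k1, k2⟩ := J_bound (a := a) (b := b) (by linarith) g3 (by linarith) (by linarith)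
      (by linarith) (h2 a b (by linarith) (by linarith) (by linarith) ha3 hb4)
    rcases le_or_gt θ' (tau (2 * a - 1/2)) with hh | hh
    · rcases hh.eq_or_lt with h | h
      · rw [← h] at k1; linarith
      · have := PP_strictMono h; linarith
    · have := QQ_mono hh.le; linarith
  refine ⟨θ, t0, t1, hq, hlt, ?_⟩
  have hPa : PP θ ≤ a0 := by linarith
  rcases hPa.eq_or_lt with he | hl
  · left
    refine ⟨he.symm, ?_, hbQ⟩
    by_contra hc
    push Not at hc
    obtain ⟨θ', t0', t1', ht'⟩ := QQ_left θ t0 hc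
    have := hlow θ' t0' (by linarith) (by rw [← he]; exact PP_strictMono t1')
    linarith
  · right
    exact ⟨hl, by linarith, le_antisymm hbQ (hlow θ t0 t1 hl)⟩

/-! ### Words -/

lemma lex_of_counts : ∀ (v w : List Bool), v.length = w.length →
    (∀ i ≤ v.length, (v.take i).count true ≤ (w.take i).count true) →
    v = w ∨ List.Lex (· < ·) v w := by
  intro v
  induction v with
  | nil =>
    intro w hl _
    left
    exact (List.length_eq_zero_iff.1 hl.symm).symm
  | cons x v ih =>
    intro w hl hc
    cases w with
    | nil => simp at hl
    | cons y w =>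
      by_cases hxy : x = y
      · subst hxy
        have := ih w (by simpa using hl) (fun i hi => by
          have := hc (i+1) (by simpa using hi)
          simpa [List.count_cons] using this)
        rcases this with h | h
        · left; rw [h]
        · right; exact List.Lex.cons h
      · right
        have h1 := hc 1 (by simp)
        cases x <;> cases y
        · exact absurd rfl hxy
        · exact List.Lex.rel (by decide)
        · simp at h1
        · exact absurd rfl hxy

lemma count_map_range (f : ℕ → Bool) (B : ℕ → ℤ) (h0 : B 0 = 0)
    (hB : ∀ n, (if f n then (1:ℤ) else 0) = B (n+1) - B n) (n : ℕ) :
    ((((List.range n).map f).count true : ℕ) : ℤ) = B n := by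
  induction n with
  | zero => simp [h0]
  | succ n ih =>
    rw [List.range_succ, List.map_append, List.count_append]
    push_cast
    rw [ih]
    have := hB n
    cases h : f n <;> simp [h] at this ⊢ <;> linarith

lemma range_append_periodic (f : ℕ → Bool) (q : ℕ) (hper : ∀ n, f (n + q) = f n) :
    (List.range q).map f ++ (List.range q).map f = (List.range (q + q)).map f := by
  rw [List.range_add, List.map_append, List.map_map]
  congr 1
  apply List.map_congr_left
  intro a _
  simp [add_comm q a, hper]

lemma cycBalanced_of (f : ℕ → Bool) (B : ℕ → ℤ) (h0 : B 0 = 0)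
    (hB : ∀ n, (if f n then (1:ℤ) else 0) = B (n+1) - B n) (q : ℕ) (hper : ∀ n, f (n + q) = f n)
    (hbal : ∀ i j k, (B (i + k) - B i) - (B (j + k) - B j) ≤ 1) :
    CycBalanced ((List.range q).map f) := by
  unfold CycBalanced BalancedWord
  rw [range_append_periodic f q hper]
  have key : ∀ u : List Bool, u <:+: (List.range (q + q)).map f →
      ∃ i, ((u.count true : ℕ) : ℤ) = B (i + u.length) - B i := by
    rintro u ⟨s, t, h⟩
    refine ⟨s.length, ?_⟩
    have hlen : s.length + u.length + t.length = q + q := by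
      have := congrArg List.length h
      simp at this
      omega
    have e1 : s ++ u = (List.range (s.length + u.length)).map f := by
      have := congrArg (List.take (s.length + u.length)) h
      rw [List.take_left' (by simp), ← List.map_take, List.take_range,
        min_eq_left (by omega)] at this
      exact this
    have e2 : s = (List.range s.length).map f := by
      have := congrArg (List.take s.length) e1
      rw [List.take_left' rfl, ← List.map_take, List.take_range, min_eq_left (by omega)] at this
      exact this
    have c1 := count_map_range f B h0 hB (s.length + u.length)
    have c2 := count_map_range f B h0 hB s.length
    rw [← e1, List.count_append] at c1
    rw [← e2] at c2
    push_cast at c1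
    linarith
  intro u v hu hv huv
  obtain ⟨i, hi⟩ := key u hu
  obtain ⟨j, hj⟩ := key v hv
  rw [hi, hj, ← huv]
  exact hbal _ _ _

/-- Counting lemma: factors of cyclically balanced words have nearly the mean number of ones. -/
lemma balanced_counts (w : List Bool) (p : ℕ) (hp : w.count true = p) (hq : 2 ≤ w.length)
    (hw : CycBalanced w) (k : ℕ) (hk : k + 1 ≤ w.length) :
    ((w.length : ℤ) * ((((w.take (k+1)).count true : ℕ) : ℤ) - ((w.take 1).count true : ℕ) - 1)
      < k * p) ∧
    ((k : ℤ) * p <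
      w.length * ((((w.take (k+1)).count true : ℕ) : ℤ) - ((w.take 1).count true : ℕ) + 1)) := by
  set q := w.length with hqd
  set A : ℕ → ℤ := fun n => ((((w ++ w).take n).count true : ℕ) : ℤ) with hA
  have hAq : ∀ i, A (q + i) = p + ((w.take i).count true : ℕ) := by
    intro i
    simp only [hA]
    rw [hqd, List.take_length_add_append, List.count_append, hp]
    push_cast; rfl
  have hA0 : ∀ i ≤ q, A i = ((w.take i).count true : ℕ) := by
    intro i hi
    simp only [hA]
    rw [List.take_append_of_le_length hi]
  have hper : ∀ i ≤ q, A (q + i) = A i + p := by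
    intro i hi
    rw [hAq, hA0 i hi]; ring
  have hfac : ∀ i k, A (i + k) - A i = (((((w ++ w).drop i).take k).count true : ℕ) : ℤ) := by
    intro i k
    simp only [hA]
    rw [List.take_add, List.count_append]
    push_cast; ring
  have hbal : ∀ i j, i < q → j < q → (A (i + k) - A i) - (A (j + k) - A j) ≤ 1 := by
    intro i j hi hj
    rw [hfac, hfac]
    apply hw
    · exact (List.take_prefix _ _).isInfix.trans (List.drop_suffix _ _).isInfix
    · exact (List.take_prefix _ _).isInfix.trans (List.drop_suffix _ _).isInfix
    · simp only [List.length_take, List.length_drop, List.length_append]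
      omega
  have hsum : ∀ m ≤ q, ∑ i ∈ Finset.range q, (A (i + m) - A i) = m * p := by
    intro m
    induction m with
    | zero => intro _; simp
    | succ m ih =>
      intro hm
      have h1 := ih (by omega)
      have h2 : ∑ i ∈ Finset.range q, (A (i + 1 + m) - A (i + m)) = A (q + m) - A (0 + m) :=
        Finset.sum_range_sub (fun i => A (i + m)) q
      rw [hper m (by omega), zero_add] at h2
      have h3 : ∑ i ∈ Finset.range q, (A (i + (m + 1)) - A i) =
          ∑ i ∈ Finset.range q, (A (i + m) - A i) +
          ∑ i ∈ Finset.range q, (A (i + 1 + m) - A (i + m)) := by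
        rw [← Finset.sum_add_distrib]
        refine Finset.sum_congr rfl (fun i _ => ?_)
        rw [show i + 1 + m = i + (m + 1) by ring]; ring
      rw [h3, h1, h2]; push_cast; ring
  have hs := hsum k (by omega)
  have hc1 := hA0 (k+1) hk
  have hc2 := hA0 1 (by omega)
  rw [← hc1, ← hc2, add_comm k 1, ← hs]
  set c := A (1 + k) - A 1 with hc
  have hcard : ∀ z : ℤ, (q : ℤ) * z = ∑ i ∈ Finset.range q, z := by intro z; simp
  rw [hcard, hcard]
  constructor
  · refine Finset.sum_lt_sum (fun i hi => ?_) ⟨1, Finset.mem_range.2 (by omega), ?_⟩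
    · have := hbal 1 i (by omega) (Finset.mem_range.1 hi)
      linarith
    · linarith
  · refine Finset.sum_lt_sum (fun i hi => ?_) ⟨1, Finset.mem_range.2 (by omega), ?_⟩
    · have := hbal i 1 (Finset.mem_range.1 hi) (by omega)
      linarith
    · linarith

/-- digits of the lower sequence -/
def sd (θ : ℝ) (n : ℕ) : Bool := decide (⌈(n:ℝ) * θ⌉ ≠ ⌈(n:ℝ) * θ + -θ⌉)
/-- digits of the upper sequence -/
def td (θ : ℝ) (n : ℕ) : Bool := decide (⌊(n:ℝ) * θ⌋ ≠ ⌊(n:ℝ) * θ + -θ⌋)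

lemma sd_val {θ : ℝ} (h0 : 0 < θ) (h1 : θ < 1) (n : ℕ) :
    (if sd θ n then (1:ℤ) else 0) = ⌈(n:ℝ) * θ⌉ - ⌈(n:ℝ) * θ + -θ⌉ := by
  have a1 : ⌈(n:ℝ) * θ + -θ⌉ ≤ ⌈(n:ℝ) * θ⌉ := Int.ceil_mono (by linarith)
  have a2 : ⌈(n:ℝ) * θ⌉ ≤ ⌈(n:ℝ) * θ + -θ⌉ + 1 := by
    rw [← Int.ceil_add_one]; exact Int.ceil_mono (by linarith)
  unfold sd
  by_cases h : ⌈(n:ℝ) * θ⌉ = ⌈(n:ℝ) * θ + -θ⌉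
  · simp [h]
  · simp only [h, ne_eq, not_false_eq_true, decide_true, if_true]; omega

lemma td_val {θ : ℝ} (h0 : 0 < θ) (h1 : θ < 1) (n : ℕ) :
    (if td θ n then (1:ℤ) else 0) = ⌊(n:ℝ) * θ⌋ - ⌊(n:ℝ) * θ + -θ⌋ := by
  have a1 : ⌊(n:ℝ) * θ + -θ⌋ ≤ ⌊(n:ℝ) * θ⌋ := Int.floor_mono (by linarith)
  have a2 : ⌊(n:ℝ) * θ⌋ ≤ ⌊(n:ℝ) * θ + -θ⌋ + 1 := by
    rw [← Int.floor_add_one]; exact Int.floor_mono (by linarith)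
  unfold td
  by_cases h : ⌊(n:ℝ) * θ⌋ = ⌊(n:ℝ) * θ + -θ⌋
  · simp [h]
  · simp only [h, ne_eq, not_false_eq_true, decide_true, if_true]; omega

lemma ceil_neg_zero {θ : ℝ} (h0 : 0 < θ) (h1 : θ < 1) : ⌈-θ⌉ = 0 := by
  rw [Int.ceil_eq_iff]; constructor <;> push_cast <;> linarith

lemma floor_neg_one {θ : ℝ} (h0 : 0 < θ) (h1 : θ < 1) : ⌊-θ⌋ = -1 := by
  rw [Int.floor_eq_iff]; constructor <;> push_cast <;> linarith

lemma ceil_diff (x y z : ℝ) : (⌈x + z⌉ - ⌈x⌉) - (⌈y + z⌉ - ⌈y⌉) ≤ 1 := by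
  have h1 := Int.ceil_lt_add_one (x + z)
  have h2 := Int.le_ceil x
  have h3 := Int.le_ceil (y + z)
  have h4 := Int.ceil_lt_add_one y
  have : ((⌈x + z⌉ - ⌈x⌉ - (⌈y + z⌉ - ⌈y⌉) : ℤ) : ℝ) < (2 : ℤ) := by push_cast; linarith
  have := Int.cast_lt.1 this
  omega

lemma floor_diff (x y z : ℝ) : (⌊x + z⌋ - ⌊x⌋) - (⌊y + z⌋ - ⌊y⌋) ≤ 1 := by
  have h1 := Int.floor_le (x + z)
  have h2 := Int.lt_floor_add_one x
  have h3 := Int.lt_floor_add_one (y + z)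
  have h4 := Int.floor_le y
  have : ((⌊x + z⌋ - ⌊x⌋ - (⌊y + z⌋ - ⌊y⌋) : ℤ) : ℝ) < (2 : ℤ) := by push_cast; linarith
  have := Int.cast_lt.1 this
  omega

lemma rat_mul_den (r : ℚ) : (r.den : ℝ) * (r : ℝ) = r.num := by
  have := Rat.mul_den_eq_num r
  have h : ((r * r.den : ℚ) : ℝ) = ((r.num : ℚ) : ℝ) := by rw [this]
  push_cast at h
  linarith

lemma sd_per (r : ℚ) (n : ℕ) : sd r (n + r.den) = sd r n := by
  unfold sd
  have e : ((n + r.den : ℕ) : ℝ) * (r:ℝ) = n * r + (r.num : ℤ) := by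
    push_cast; rw [add_mul, rat_mul_den]
  rw [e, Int.ceil_add_intCast, add_right_comm, Int.ceil_add_intCast]
  simp

lemma td_per (r : ℚ) (n : ℕ) : td r (n + r.den) = td r n := by
  unfold td
  have e : ((n + r.den : ℕ) : ℝ) * (r:ℝ) = n * r + (r.num : ℤ) := by
    push_cast; rw [add_mul, rat_mul_den]
  rw [e, Int.floor_add_intCast, add_right_comm, Int.floor_add_intCast]
  simp

lemma two_le_den {r : ℚ} (h0 : 0 < r) (h1 : r < 1) : 2 ≤ r.den := by
  by_contra hc
  have hd : r.den = 1 := by have := r.den_pos; omega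
  have e : (r.num : ℚ) = r := Rat.den_eq_one_iff r |>.1 hd
  rw [← e] at h0 h1
  have a1 : (0:ℤ) < r.num := by exact_mod_cast h0
  have a2 : r.num < (1:ℤ) := by exact_mod_cast h1
  omega

def sW (r : ℚ) : List Bool := (List.range r.den).map (sd r)
def tW (r : ℚ) : List Bool := (List.range r.den).map (td r)

lemma head_map_range (f : ℕ → Bool) (q : ℕ) (hq : 0 < q) :
    ((List.range q).map f).head? = some (f 0) := by
  obtain ⟨m, rfl⟩ : ∃ m, q = m + 1 := ⟨q - 1, by omega⟩
  rw [List.range_succ_eq_map]; rfl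

lemma cast01 {r : ℚ} (h0 : 0 < r) (h1 : r < 1) : (0:ℝ) < r ∧ (r:ℝ) < 1 :=
  ⟨by exact_mod_cast h0, by exact_mod_cast h1⟩

lemma sW_count {r : ℚ} (h0 : 0 < r) (h1 : r < 1) (n : ℕ) :
    ((((List.range n).map (sd r)).count true : ℕ) : ℤ) = ⌈(n:ℝ) * r + -r⌉ := by
  obtain ⟨k0, k1⟩ := cast01 h0 h1
  refine count_map_range (sd r) (fun n => ⌈(n:ℝ) * r + -r⌉) ?_ (fun n => ?_) n
  · simp only [Nat.cast_zero, zero_mul, zero_add]; exact ceil_neg_zero k0 k1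
  · rw [sd_val k0 k1]; push_cast; congr 2; ring

lemma tW_count {r : ℚ} (h0 : 0 < r) (h1 : r < 1) (n : ℕ) :
    ((((List.range n).map (td r)).count true : ℕ) : ℤ) = ⌊(n:ℝ) * r + -r⌋ + 1 := by
  obtain ⟨k0, k1⟩ := cast01 h0 h1
  refine count_map_range (td r) (fun n => ⌊(n:ℝ) * r + -r⌋ + 1) ?_ (fun n => ?_) n
  · simp only [Nat.cast_zero, zero_mul, zero_add]; rw [floor_neg_one k0 k1]; rfl
  · rw [td_val k0 k1]; push_cast; rw [add_sub_add_right_eq_sub]; congr 2; ring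

lemma sd_zero {θ : ℝ} (h0 : 0 < θ) (h1 : θ < 1) : sd θ 0 = false := by
  unfold sd; simp [ceil_neg_zero h0 h1]
lemma td_zero {θ : ℝ} (h0 : 0 < θ) (h1 : θ < 1) : td θ 0 = true := by
  unfold td; simp [floor_neg_one h0 h1]
lemma sd_one {θ : ℝ} (h0 : 0 < θ) (h1 : θ < 1) : sd θ 1 = true := by
  have : ⌈θ⌉ = 1 := by rw [Int.ceil_eq_iff]; constructor <;> push_cast <;> linarith
  unfold sd; simp [this]
lemma td_one {θ : ℝ} (h0 : 0 < θ) (h1 : θ < 1) : td θ 1 = false := by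
  have : ⌊θ⌋ = 0 := by rw [Int.floor_eq_iff]; constructor <;> push_cast <;> linarith
  unfold td; simp [this]

lemma sW_mem {r : ℚ} (h0 : 0 < r) (h1 : r < 1) : sW r ∈ OmegaSet r false := by
  obtain ⟨k0, k1⟩ := cast01 h0 h1
  have hnum : 0 < r.num := Rat.num_pos.2 h0
  refine ⟨by simp [sW], ?_, ?_, ?_⟩
  · have := sW_count h0 h1 r.den
    rw [rat_mul_den, add_comm, Int.ceil_add_intCast, ceil_neg_zero k0 k1] at this
    unfold sW
    omega
  · refine cycBalanced_of (sd r) (fun n => ⌈(n:ℝ) * r + -r⌉) ?_ (fun n => ?_) _ (sd_per r) ?_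
    · simp only [Nat.cast_zero, zero_mul, zero_add]; exact ceil_neg_zero k0 k1
    · rw [sd_val k0 k1]; push_cast; congr 2; ring
    · intro i j k
      have := ceil_diff ((i:ℝ) * r + -r) ((j:ℝ) * r + -r) (k * r)
      push_cast
      rw [show ((i:ℝ) + k) * r + -r = (i:ℝ) * r + -r + k * r by ring,
        show ((j:ℝ) + k) * r + -r = (j:ℝ) * r + -r + k * r by ring]
      exact this
  · unfold sW; rw [head_map_range _ _ r.den_pos, sd_zero k0 k1]

lemma tW_mem {r : ℚ} (h0 : 0 < r) (h1 : r < 1) : tW r ∈ OmegaSet r true := by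
  obtain ⟨k0, k1⟩ := cast01 h0 h1
  have hnum : 0 < r.num := Rat.num_pos.2 h0
  refine ⟨by simp [tW], ?_, ?_, ?_⟩
  · have := tW_count h0 h1 r.den
    rw [rat_mul_den, add_comm (r.num : ℝ), Int.floor_add_intCast, floor_neg_one k0 k1] at this
    unfold tW
    omega
  · refine cycBalanced_of (td r) (fun n => ⌊(n:ℝ) * r + -r⌋ + 1) ?_ (fun n => ?_) _ (td_per r) ?_
    · simp only [Nat.cast_zero, zero_mul, zero_add]; rw [floor_neg_one k0 k1]; rfl
    · rw [td_val k0 k1]; push_cast; rw [add_sub_add_right_eq_sub]; congr 2; ring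
    · intro i j k
      have := floor_diff ((i:ℝ) * r + -r) ((j:ℝ) * r + -r) (k * r)
      push_cast
      rw [show ((i:ℝ) + k) * r + -r = (i:ℝ) * r + -r + k * r by ring,
        show ((j:ℝ) + k) * r + -r = (j:ℝ) * r + -r + k * r by ring]
      linarith
  · unfold tW; rw [head_map_range _ _ r.den_pos, td_zero k0 k1]

lemma omega_counts {r : ℚ} (h0 : 0 < r) (h1 : r < 1) {b : Bool} {v : List Bool}
    (hv : v ∈ OmegaSet r b) (k : ℕ) (hk : k + 1 ≤ v.length) :
    (((v.take (k+1)).count true : ℕ) : ℤ) ≤ ⌈(k:ℝ) * r⌉ + (if b then 1 else 0) ∧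
    ⌊(k:ℝ) * r⌋ + (if b then 1 else 0) ≤ (((v.take (k+1)).count true : ℕ) : ℤ) := by
  obtain ⟨hl, hc, hb, hh⟩ := hv
  have hnum : 0 < r.num := Rat.num_pos.2 h0
  obtain ⟨g1, g2⟩ := balanced_counts v _ hc (by rw [hl]; exact two_le_den h0 h1) hb k hk
  have e1 : (((v.take 1).count true : ℕ) : ℤ) = if b then 1 else 0 := by
    cases v with
    | nil => simp at hh
    | cons x v =>
      simp at hh; subst hh
      cases x <;> simp
  rw [e1, hl] at g1 g2
  have e2 : ((r.num.toNat : ℕ) : ℤ) = r.num := Int.toNat_of_nonneg hnum.le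
  rw [e2] at g1 g2
  set c := (((v.take (k+1)).count true : ℕ) : ℤ)
  set d : ℤ := if b then 1 else 0
  have hden : (0:ℝ) < r.den := by exact_mod_cast r.den_pos
  have hmul := rat_mul_den r
  have g1' : (r.den : ℝ) * ((c:ℝ) - d - 1) < k * r.num := by exact_mod_cast g1
  have g2' : (k : ℝ) * r.num < r.den * ((c:ℝ) - d + 1) := by exact_mod_cast g2
  rw [← hmul] at g1' g2'
  constructor
  · have : c - d - 1 < ⌈(k:ℝ) * r⌉ := by
      rw [Int.lt_ceil]; push_cast
      have : (r.den : ℝ) * ((c:ℝ) - d - 1) < r.den * (k * r) := by linarith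
      exact lt_of_mul_lt_mul_left this hden.le
    omega
  · have : ⌊(k:ℝ) * r⌋ < c - d + 1 := by
      rw [Int.floor_lt]; push_cast
      have : (r.den : ℝ) * (k * r) < r.den * ((c:ℝ) - d + 1) := by linarith
      exact lt_of_mul_lt_mul_left this hden.le
    omega

lemma sW_isOmega {r : ℚ} (h0 : 0 < r) (h1 : r < 1) : IsOmegaMinus r (sW r) := by
  refine ⟨sW_mem h0 h1, fun v hv => lex_of_counts _ _ ?_ (fun i hi => ?_)⟩
  · rw [hv.1, (sW_mem h0 h1).1]
  · rcases i with _ | k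
    · simp
    · have := (omega_counts h0 h1 hv k hi).1
      have hk : k + 1 ≤ r.den := by rw [← hv.1]; exact hi
      have e := sW_count h0 h1 (k+1)
      unfold sW
      rw [← List.map_take, List.take_range, min_eq_left hk]
      push_cast at e
      rw [show ((k:ℝ) + 1) * r + -r = k * r by ring] at e
      simp at this
      omega

lemma tW_isOmega {r : ℚ} (h0 : 0 < r) (h1 : r < 1) : IsOmegaPlus r (tW r) := by
  refine ⟨tW_mem h0 h1, fun v hv => ?_⟩
  have : tW r = v ∨ List.Lex (· < ·) (tW r) v := by
    have hl : (tW r).length = v.length := by rw [hv.1, (tW_mem h0 h1).1]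
    refine lex_of_counts _ _ hl (fun i hi => ?_)
    rcases i with _ | k
    · simp
    · have := (omega_counts h0 h1 hv k (by omega)).2
      have hk : k + 1 ≤ r.den := by rw [← hv.1]; omega
      have e := tW_count h0 h1 (k+1)
      unfold tW
      rw [← List.map_take, List.take_range, min_eq_left hk]
      push_cast at e
      rw [show ((k:ℝ) + 1) * r + -r = k * r by ring] at e
      simp at this
      omega
  rcases this with h | h
  · left; exact h.symm
  · right; exact h

lemma omegaMinus_eq {r : ℚ} (h0 : 0 < r) (h1 : r < 1) : omegaMinus r = sW r := by
  have hs := sW_isOmega h0 h1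
  have hex : ∃ w, IsOmegaMinus r w := ⟨_, hs⟩
  have hw := hex.choose_spec
  unfold omegaMinus
  rw [dif_pos hex]
  rcases hw.2 _ hs.1 with h | h
  · exact h.symm
  rcases hs.2 _ hw.1 with h' | h'
  · exact h'
  · exact absurd h' (asymm_of (List.Lex (· < ·)) h)

lemma omegaPlus_eq {r : ℚ} (h0 : 0 < r) (h1 : r < 1) : omegaPlus r = tW r := by
  have hs := tW_isOmega h0 h1
  have hex : ∃ w, IsOmegaPlus r w := ⟨_, hs⟩
  have hw := hex.choose_spec
  unfold omegaPlus
  rw [dif_pos hex]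
  rcases hw.2 _ hs.1 with h | h
  · exact h.symm
  rcases hs.2 _ hw.1 with h' | h'
  · exact h'
  · exact absurd h' (asymm_of (List.Lex (· < ·)) h)

lemma per_map_range (f : ℕ → Bool) (q : ℕ) (hq : 0 < q) (hper : ∀ n, f (n + q) = f n) :
    per ((List.range q).map f) = f := by
  ext n
  unfold per
  have hlt : n % q < q := Nat.mod_lt _ hq
  have hp : Function.Periodic f q := hper
  simp [List.getD_eq_getElem?_getD, hlt, hp.map_mod_nat]

lemma cat_map_range (f g : ℕ → Bool) (q : ℕ) (hper : ∀ n, g (n + q) = g n) (n : ℕ) :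
    cat ((List.range q).map f) g n = if n < q then f n else g n := by
  unfold cat
  simp only [List.length_map, List.length_range]
  split_ifs with h
  · simp [List.getD_eq_getElem?_getD, h]
  · have := hper (n - q)
    rw [Nat.sub_add_cancel (by omega)] at this
    exact this.symm

lemma piMap_sd {θ : ℝ} (h0 : 0 < θ) (h1 : θ < 1) : piMap (sd θ) = PP θ := by
  have : piMap (sd θ) = Fc θ 0 - Fc θ (-θ) := by
    unfold piMap Fc
    rw [← (summable_ceil θ 0 1).tsum_sub (summable_ceil θ (-θ) 1)]
    refine tsum_congr (fun n => ?_)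
    rw [← sub_div]
    congr 1
    have := sd_val h0 h1 n
    rw [add_zero]
    exact_mod_cast congrArg (Int.cast : ℤ → ℝ) this
  rw [this, Fc_zero, Fc_neg h0 h1]; ring

lemma piMap_td {θ : ℝ} (h0 : 0 < θ) (h1 : θ < 1) : piMap (td θ) = QQ θ := by
  have : piMap (td θ) = Hf θ 0 - Hf θ (-θ) := by
    unfold piMap Hf
    rw [← (summable_floor θ 0 1).tsum_sub (summable_floor θ (-θ) 1)]
    refine tsum_congr (fun n => ?_)
    rw [← sub_div]
    congr 1
    have := td_val h0 h1 n
    rw [add_zero]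
    exact_mod_cast congrArg (Int.cast : ℤ → ℝ) this
  rw [this, Hf_zero, Hf_neg h0 h1]; ring

lemma piMap_summable (f : ℕ → Bool) :
    Summable (fun n : ℕ => (if f n then (1:ℝ) else 0) / 2 ^ (n+1)) :=
  summable_aux _ 1 1 (fun n => by
    have : (0:ℝ) ≤ n := Nat.cast_nonneg n
    split_ifs
    · simp
    · simp; linarith)

lemma piMap_swap {f g : ℕ → Bool} (f0 : f 0 = true) (f1 : f 1 = false) (g0 : g 0 = false)
    (g1 : g 1 = true) (h : ∀ n, f (n+2) = g (n+2)) : piMap f = piMap g + 1/4 := by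
  unfold piMap
  rw [← (piMap_summable f).sum_add_tsum_nat_add 2, ← (piMap_summable g).sum_add_tsum_nat_add 2]
  simp only [h, Finset.sum_range_succ, Finset.sum_range_zero, f0, f1, g0, g1]
  norm_num
  ring

lemma ceil_eq_floor_add {r : ℚ} (n : ℕ) (hn : 0 < n) (hn2 : n < r.den) :
    ⌈(n:ℝ) * r⌉ = ⌊(n:ℝ) * r⌋ + 1 := by
  have a1 := Int.floor_le ((n:ℝ) * r)
  have a2 := Int.lt_floor_add_one ((n:ℝ) * r)
  rw [Int.ceil_eq_iff]
  push_cast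
  refine ⟨?_, a2.le⟩
  rw [add_sub_cancel_right]
  refine lt_of_le_of_ne a1 (fun he => ?_)
  set z := ⌊(n:ℝ) * r⌋
  have e : (n : ℝ) * r.num = z * r.den := by
    rw [← rat_mul_den, he]; ring
  have e' : (n : ℤ) * r.num = z * r.den := by exact_mod_cast e
  have hd : (r.den : ℤ) ∣ n * r.num := ⟨z, by rw [e']; ring⟩
  have hcop : IsCoprime (r.den : ℤ) r.num := by
    rw [Int.isCoprime_iff_gcd_eq_one, Int.gcd_comm]
    simpa [Int.gcd] using r.reduced
  have := hcop.dvd_of_dvd_mul_right hd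
  have := Int.le_of_dvd (by exact_mod_cast hn) this
  omega

lemma sd_eq_td {r : ℚ} (n : ℕ) (hn : n + 2 < r.den) : sd r (n+2) = td r (n+2) := by
  unfold sd td
  have e : ((n + 2 : ℕ) : ℝ) * (r:ℝ) + -r = ((n+1 : ℕ) : ℝ) * r := by push_cast; ring
  rw [e, ceil_eq_floor_add (n+2) (by omega) hn, ceil_eq_floor_add (n+1) (by omega) (by omega)]
  simp

lemma per_minus {r : ℚ} (h0 : 0 < r) (h1 : r < 1) : piMap (per (omegaMinus r)) = PP r := by
  obtain ⟨k0, k1⟩ := cast01 h0 h1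
  rw [omegaMinus_eq h0 h1, sW, per_map_range _ _ r.den_pos (sd_per r), piMap_sd k0 k1]

lemma per_plus {r : ℚ} (h0 : 0 < r) (h1 : r < 1) : piMap (per (omegaPlus r)) = QQ r := by
  obtain ⟨k0, k1⟩ := cast01 h0 h1
  rw [omegaPlus_eq h0 h1, tW, per_map_range _ _ r.den_pos (td_per r), piMap_td k0 k1]

lemma cat_plus_minus {r : ℚ} (h0 : 0 < r) (h1 : r < 1) :
    piMap (cat (omegaPlus r) (per (omegaMinus r))) = PP r + 1/4 := by
  obtain ⟨k0, k1⟩ := cast01 h0 h1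
  have hd := two_le_den h0 h1
  rw [omegaMinus_eq h0 h1, omegaPlus_eq h0 h1, sW, tW, per_map_range _ _ r.den_pos (sd_per r),
    ← piMap_sd k0 k1]
  apply piMap_swap
  · rw [cat_map_range _ _ _ (sd_per r), if_pos (by omega), td_zero k0 k1]
  · rw [cat_map_range _ _ _ (sd_per r), if_pos (by omega), td_one k0 k1]
  · exact sd_zero k0 k1
  · exact sd_one k0 k1
  · intro n
    rw [cat_map_range _ _ _ (sd_per r)]
    split_ifs with h
    · exact (sd_eq_td n h).symm
    · rfl

lemma cat_minus_plus {r : ℚ} (h0 : 0 < r) (h1 : r < 1) :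
    piMap (cat (omegaMinus r) (per (omegaPlus r))) = QQ r - 1/4 := by
  obtain ⟨k0, k1⟩ := cast01 h0 h1
  have hd := two_le_den h0 h1
  rw [omegaMinus_eq h0 h1, omegaPlus_eq h0 h1, sW, tW, per_map_range _ _ r.den_pos (td_per r),
    ← piMap_td k0 k1]
  rw [eq_sub_iff_add_eq]
  symm
  apply piMap_swap
  · exact td_zero k0 k1
  · exact td_one k0 k1
  · rw [cat_map_range _ _ _ (td_per r), if_pos (by omega), sd_zero k0 k1]
  · rw [cat_map_range _ _ _ (td_per r), if_pos (by omega), sd_one k0 k1]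
  · intro n
    rw [cat_map_range _ _ _ (td_per r)]
    split_ifs with h
    · exact (sd_eq_td n h).symm
    · rfl

lemma DeltaI_eq {r : ℚ} (h0 : 0 < r) (h1 : r < 1) : DeltaI [r] = Set.Icc (PP r) (QQ r - 1/4) := by
  have e1 : sWord [r] = omegaMinus r := by simp [sWord, substR]
  have e2 : tWord [r] = omegaPlus r := by simp [tWord, substR]
  rw [DeltaI, e1, e2, per_minus h0 h1, cat_minus_plus h0 h1]

theorem stmt15 (a0 b0 : ℝ) (h : FOCH a0 b0) :
    (∃ a ∈ Set.Ioc (0:ℝ) (1/4),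
      (a0 = a ∧ b0 = 1/2) ∨ (a0 = 1/2 ∧ b0 = 1 - a)) ∨
    (a0 ∈ Scal ∧ b0 = a0 + 1/4) ∨
    (∃ r : ℚ, 0 < r ∧ r < 1 ∧ a0 = piMap (per (omegaMinus r)) ∧
      b0 ∈ Set.Icc (piMap (cat (omegaPlus r) (per (omegaMinus r))))
        (piMap (per (omegaPlus r)))) ∨
    (∃ r : ℚ, 0 < r ∧ r < 1 ∧
      a0 ∈ Set.Ioc (piMap (per (omegaMinus r)))
        (piMap (cat (omegaMinus r) (per (omegaPlus r)))) ∧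
      b0 = piMap (per (omegaPlus r))) := by
  rcases classify h with ⟨h1, h2, h3⟩ | ⟨h1, h2, h3⟩ | ⟨θ, t0, t1, q1, q2, hc⟩
  · left
    exact ⟨a0, ⟨h1, h2⟩, Or.inl ⟨rfl, h3⟩⟩
  · left
    exact ⟨1 - b0, ⟨by linarith, by linarith⟩, Or.inr ⟨h1, by ring⟩⟩
  right
  by_cases hr : Irrational θ
  · left
    have e := PP_irr hr
    rcases hc with ⟨c1, c2, c3⟩ | ⟨c1, c2, c3⟩
    · refine ⟨⟨⟨q1, q2⟩, ?_⟩, by linarith⟩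
      simp only [Set.mem_iUnion, not_exists]
      rintro r ⟨r0, r1⟩ hmem
      rw [DeltaI_eq r0 r1, c1] at hmem
      rcases lt_trichotomy (r:ℝ) θ with hlt | heq | hgt
      · have := QQ_lt_PP hlt
        linarith [hmem.2]
      · exact hr ⟨r, heq⟩
      · have := PP_strictMono hgt
        linarith [hmem.1]
    · linarith
  · right
    unfold Irrational at hr
    push Not at hr
    obtain ⟨r, rfl⟩ := hr
    have r0 : 0 < r := by exact_mod_cast t0
    have r1 : r < 1 := by exact_mod_cast t1
    rcases hc with ⟨c1, c2, c3⟩ | ⟨c1, c2, c3⟩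
    · left
      refine ⟨r, r0, r1, ?_, ?_⟩
      · rw [per_minus r0 r1, c1]
      · rw [cat_plus_minus r0 r1, per_plus r0 r1]; exact ⟨c2, c3⟩
    · right
      refine ⟨r, r0, r1, ?_, ?_⟩
      · rw [per_minus r0 r1, cat_minus_plus r0 r1]; exact ⟨c1, c2⟩
      · rw [per_plus r0 r1, c3]

end
end

section
/- Let (s,t) be an extremal pair of finite binary words with |s| = N, and write s = s_1⋯s_N. If σʲ(s^∞) ≺ s^∞ for some j ∈ {1,…,N−1} and s_{j+1}⋯s_N = s_1⋯s_{N−j}, then s_{N−j+1} = 1. -/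
noncomputable section

/-- A pair `(s,t)` of finite binary words (s beginning with 0, t with 1) is extremal. -/
def Extremal (s t : List Bool) : Prop :=
  s.head? = some false ∧ t.head? = some true ∧
  (∀ k, 1 ≤ k → k ≤ s.length - 1 →
    ¬ (seqLe (per s) (shft^[k] (per s)) ∧ seqLt (shft^[k] (per s)) (per t))) ∧
  (∀ l, 1 ≤ l → l ≤ t.length - 1 →
    ¬ (seqLt (per s) (shft^[l] (per t)) ∧ seqLe (shft^[l] (per t)) (per t)))

theorem shft_iter (k : ℕ) (x : ℕ → Bool) (n : ℕ) : (shft^[k] x) n = x (n + k) := by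
  induction k generalizing x n with
  | zero => rfl
  | succ k ih =>
    rw [Function.iterate_succ_apply, ih]
    simp only [shft]
    congr 1

theorem stmt19 (s t : List Bool) (hext : Extremal s t) (N : ℕ) (hN : s.length = N)
    (j : ℕ) (hj1 : 1 ≤ j) (hjN : j ≤ N - 1)
    (hlt : seqLt (shft^[j] (per s)) (per s))
    (heq : s.drop j = s.take (N - j)) :
    s.getD (N - j) false = true := by
  obtain ⟨-, ht, h1, -⟩ := hext
  by_contra hc
  have hf : s.getD (N - j) false = false := by simpa using hc
  refine h1 (N - j) (by omega) (by omega) ⟨Or.inl ?_, 0, by simp, ?_⟩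
  · obtain ⟨n, hn1, hn2⟩ := hlt
    have hm : ∀ i < N - j, per s (i + j) = per s i := by
      intro i hi
      have e1 : (i + j) % s.length = i + j := Nat.mod_eq_of_lt (by omega)
      have e2 : i % s.length = i := Nat.mod_eq_of_lt (by omega)
      have h := congrArg (fun l => l[i]?) heq
      simp only [List.getElem?_drop, List.getElem?_take, hi, if_true] at h
      simp only [per, e1, e2, List.getD_eq_getElem?_getD]
      rw [← h, Nat.add_comm]
    have hp : ∀ i, per s (i + (N - j) + j) = per s i := by
      intro i
      have : i + (N - j) + j = i + s.length := by omega
      rw [this]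
      simp [per]
    simp only [shft_iter] at hn1 hn2
    have hnm : N - j ≤ n := by
      by_contra hlt
      rw [hm n (by omega)] at hn2
      exact lt_irrefl _ hn2
    obtain ⟨d, rfl⟩ := Nat.exists_eq_add_of_le' hnm
    refine ⟨d, fun i hi => ?_, ?_⟩
    · rw [shft_iter, ← hn1 (i + (N - j)) (by omega), hp]
    · rw [shft_iter]
      rwa [hp] at hn2
  · rw [shft_iter]
    have e : (0 + (N - j)) % s.length = N - j := by
      rw [Nat.zero_add]
      exact Nat.mod_eq_of_lt (by omega)
    have e1 : per s (0 + (N - j)) = false := by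
      simp only [per, e, hf]
    have e2 : per t 0 = true := by
      cases t with
      | nil => simp at ht
      | cons a l => simpa [per] using ht
    rw [e1, e2]
    decide

end
end
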